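/- Fix a > 0 and 0 < b < 1, and let v(z) = e^{a|z|^b} on ℝ^{2d}. Let g ∈ L²(ℝ^d) satisfy ∫_{ℝ^{2d}} |⟨g, π(z)g⟩| e^{a|z|^b} dz < ∞, and let Λ ⊆ ℝ^{2d} be a countable relatively separated set. If G(g,Λ) is a frame for L²(ℝ^d) but not a Riesz basis, then the lower Riesz bound of the finite sections decays sub-exponentially: A_n = O(e^{−a n^b}), i.e., there exists C > 0 with A_n ≤ C e^{−a n^b} for all n ≥ 1. -/

import Mathlib

open MeasureTheory Filter

noncomputable section

abbrev Ed (d : ℕ) := EuclideanSpace ℝ (Fin d)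
abbrev E2 (d : ℕ) := EuclideanSpace ℝ (Fin d ⊕ Fin d)

def timePart {d : ℕ} (z : E2 d) : Ed d := WithLp.toLp 2 (fun i => z (Sum.inl i))
def freqPart {d : ℕ} (z : E2 d) : Ed d := WithLp.toLp 2 (fun i => z (Sum.inr i))

def tfShift {d : ℕ} (z : E2 d) (g : Ed d → ℂ) : Ed d → ℂ :=
  fun t => Complex.exp (2 * Real.pi * Complex.I *
      (∑ i : Fin d, (freqPart z i : ℂ) * (t i : ℂ))) * g (t - timePart z)

def L2inner {d : ℕ} (f h : Ed d → ℂ) : ℂ :=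
  ∫ t : Ed d, f t * (starRingEnd ℂ) (h t)

def L2normSq {d : ℕ} (f : Ed d → ℂ) : ℝ := ∫ t : Ed d, ‖f t‖ ^ 2

def gaussian (d : ℕ) : Ed d → ℂ := fun t => (Real.exp (-Real.pi * ‖t‖ ^ 2) : ℝ)

/-- A (positive, submultiplicative) weight function. -/
structure IsWeight {d : ℕ} (v : E2 d → ℝ) : Prop where
  pos : ∀ z, 0 < v z
  submul : ∀ z w, v (z + w) ≤ v z * v w

/-- The Gelfand–Raikov–Shilov condition `lim_n v(nz)^{1/n} = 1`. -/
def SatisfiesGRS {d : ℕ} (v : E2 d → ℝ) : Prop :=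
  ∀ z : E2 d, Tendsto (fun n : ℕ => Real.rpow (v ((n : ℝ) • z)) ((n : ℝ)⁻¹)) atTop (nhds 1)

/-- Subconvolutivity: `(v⁻¹ * v⁻¹)(z) ≤ C v(z)⁻¹`. -/
def Subconvolutive {d : ℕ} (v : E2 d → ℝ) : Prop :=
  ∃ C > 0, ∀ z : E2 d,
    (∫⁻ w : E2 d, ENNReal.ofReal ((v w)⁻¹ * (v (z - w))⁻¹)) ≤ ENNReal.ofReal (C * (v z)⁻¹)

/-- A set is relatively separated if balls of radius 1 contain boundedly many points. -/
def RelativelySeparated {d : ℕ} (Λ : Set (E2 d)) : Prop :=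
  ∃ N : ℕ, ∀ z : E2 d, ({l ∈ Λ | dist l z ≤ 1}).encard ≤ (N : ℕ∞)

/-- The Gabor frame inequalities with frame bounds `A, B`. -/
def GaborFrame {d : ℕ} (g : Ed d → ℂ) (Λ : Set (E2 d)) (A B : ℝ) : Prop :=
  0 < A ∧ 0 < B ∧ ∀ f : Ed d → ℂ, MemLp f 2 (volume : Measure (Ed d)) →
    A * L2normSq f ≤ (∑' l : Λ, ‖L2inner f (tfShift (l : E2 d) g)‖ ^ 2) ∧
    (∑' l : Λ, ‖L2inner f (tfShift (l : E2 d) g)‖ ^ 2) ≤ B * L2normSq f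

/-- The Bessel inequality with Bessel bound `B`. -/
def GaborBessel {d : ℕ} (g : Ed d → ℂ) (Λ : Set (E2 d)) (B : ℝ) : Prop :=
  ∀ f : Ed d → ℂ, MemLp f 2 (volume : Measure (Ed d)) →
    (∑' l : Λ, ‖L2inner f (tfShift (l : E2 d) g)‖ ^ 2) ≤ B * L2normSq f

/-- `c` lies in the kernel of the synthesis operator `D_{g,Λ}`:  the partial sums
`∑_{λ ∈ s} c_λ π(λ) g` tend to `0` in `L²`. -/
def InSynthKernel {d : ℕ} (g : Ed d → ℂ) (Λ : Set (E2 d)) (c : Λ → ℂ) : Prop :=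
  Tendsto (fun s : Finset Λ => ∫ t : Ed d, ‖∑ l ∈ s, c l * tfShift (l : E2 d) g t‖ ^ 2)
    atTop (nhds 0)

/-- A Gabor system is a Riesz basis if it is a frame and the synthesis operator has
trivial kernel on `ℓ²(Λ)`. -/
def GaborRieszBasis {d : ℕ} (g : Ed d → ℂ) (Λ : Set (E2 d)) : Prop :=
  (∃ A B : ℝ, GaborFrame g Λ A B) ∧
  ∀ c : Λ → ℂ, Summable (fun l : Λ => ‖c l‖ ^ 2) → InSynthKernel g Λ c → ∀ l, c l = 0

/-- The lower Riesz bound `A_n` of the finite section `G(g, Λ ∩ B_n(0))`. -/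
def lowerRiesz {d : ℕ} (g : Ed d → ℂ) (Λ : Set (E2 d)) (n : ℕ) : ℝ :=
  sInf { r : ℝ | ∃ (s : Finset Λ) (c : Λ → ℂ),
    (∀ l ∈ s, ‖(l : E2 d)‖ ≤ (n : ℝ)) ∧
    0 < (∑ l ∈ s, ‖c l‖ ^ 2) ∧
    r = (∫ t : Ed d, ‖∑ l ∈ s, c l * tfShift (l : E2 d) g t‖ ^ 2) / (∑ l ∈ s, ‖c l‖ ^ 2) }

/-- Membership of `g` in the modulation space `M¹_v`. -/
def MemM1 {d : ℕ} (g : Ed d → ℂ) (v : E2 d → ℝ) : Prop :=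
  ∫⁻ z : E2 d, ENNReal.ofReal (‖L2inner g (tfShift z (gaussian d))‖ * v z) < ⊤

/-- Membership of `g` in the modulation space `M^∞_v`. -/
def MemMInf {d : ℕ} (g : Ed d → ℂ) (v : E2 d → ℝ) : Prop :=
  ∃ C : ℝ, ∀ z : E2 d, ‖L2inner g (tfShift z (gaussian d))‖ * v z ≤ C

/-- The integer lattice point `k ∈ ℤ^{2d}` as an element of `ℝ^{2d}`. -/
def intVec {d : ℕ} (k : (Fin d ⊕ Fin d) → ℤ) : E2 d := WithLp.toLp 2 (fun i => (k i : ℝ))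

def unitCube (d : ℕ) : Set (E2 d) := {z | ∀ i, z i ∈ Set.Icc (0 : ℝ) 1}

/-- `sup_{z ∈ [0,1]^{2d}} |Θ(k+z)|`. -/
def cubeSup {d : ℕ} {F : Type*} [NormedAddCommGroup F] (Θ : E2 d → F)
    (k : (Fin d ⊕ Fin d) → ℤ) : ℝ :=
  sSup ((fun z => ‖Θ (intVec k + z)‖) '' unitCube d)

/-- Membership in the Wiener amalgam space `W(C, ℓ¹_v)`. -/
def MemAmalgamW {d : ℕ} {F : Type*} [NormedAddCommGroup F] (Θ : E2 d → F)
    (v : E2 d → ℝ) : Prop :=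
  Continuous Θ ∧ Summable (fun k : (Fin d ⊕ Fin d) → ℤ => cubeSup Θ k * v (intVec k))

/-- The norm of the Wiener amalgam space `W(C, ℓ¹_v)`. -/
def amalgamNorm {d : ℕ} {F : Type*} [NormedAddCommGroup F] (Θ : E2 d → F)
    (v : E2 d → ℝ) : ℝ :=
  ∑' k : (Fin d ⊕ Fin d) → ℤ, cubeSup Θ k * v (intVec k)

/-- Convolution-dominated matrices `C_v(Λ)`. -/
def MemCv {d : ℕ} {Λ : Set (E2 d)} (A : Λ → Λ → ℂ) (v : E2 d → ℝ) : Prop :=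
  ∃ Θ : E2 d → ℝ, MemAmalgamW Θ v ∧ ∀ l m : Λ, ‖A l m‖ ≤ Θ ((l : E2 d) - (m : E2 d))

/-- The norm on `C_v(Λ)`. -/
def CvNorm {d : ℕ} {Λ : Set (E2 d)} (A : Λ → Λ → ℂ) (v : E2 d → ℝ) : ℝ :=
  sInf { r : ℝ | ∃ Θ : E2 d → ℝ, MemAmalgamW Θ v ∧
    (∀ l m : Λ, ‖A l m‖ ≤ Θ ((l : E2 d) - (m : E2 d))) ∧ r = amalgamNorm Θ v }

/-- Matrices with off-diagonal decay `v⁻¹` (the class `C_v^∞(Λ)`, Jaffard class). -/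
def MemCvInf {d : ℕ} {Λ : Set (E2 d)} (A : Λ → Λ → ℂ) (v : E2 d → ℝ) : Prop :=
  ∃ C : ℝ, ∀ l m : Λ, ‖A l m‖ * v ((l : E2 d) - (m : E2 d)) ≤ C

/-- The norm on `C_v^∞(Λ)`. -/
def CvInfNorm {d : ℕ} {Λ : Set (E2 d)} (A : Λ → Λ → ℂ) (v : E2 d → ℝ) : ℝ :=
  sSup { r : ℝ | ∃ l m : Λ, r = ‖A l m‖ * v ((l : E2 d) - (m : E2 d)) }

/-- The Gram matrix `(G_{g,Λ})_{λμ} = ⟨π(μ)g, π(λ)g⟩`. -/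
def gramMatrix {d : ℕ} (g : Ed d → ℂ) (Λ : Set (E2 d)) : Λ → Λ → ℂ :=
  fun l m => L2inner (tfShift (m : E2 d) g) (tfShift (l : E2 d) g)

/-- A bounded operator `T` on `ℓ²(Λ)` is represented by the matrix `A`. -/
def Represents {d : ℕ} {Λ : Set (E2 d)}
    (T : lp (fun _ : Λ => ℂ) 2 →L[ℂ] lp (fun _ : Λ => ℂ) 2) (A : Λ → Λ → ℂ) : Prop :=
  ∀ c : lp (fun _ : Λ => ℂ) 2, ∀ l : Λ, (T c : ∀ _ : Λ, ℂ) l = ∑' m : Λ, A l m * (c : ∀ _ : Λ, ℂ) m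



/-- The standard basis vector `e_m` of `ℓ²(Λ)`. -/
def lpSingle {d : ℕ} {Λ : Set (E2 d)} (m : Λ) : lp (fun _ : Λ => ℂ) 2 :=
  haveI := Classical.decEq (↥Λ)
  lp.single 2 m (1 : ℂ)

section Auxiliary

open scoped FourierTransform ENNReal NNReal

theorem integral_smul_fourier_toLp {E : Type*} [NormedAddCommGroup E] [InnerProductSpace ℝ E]
    [FiniteDimensional ℝ E] [MeasurableSpace E] [BorelSpace E] {f : E → ℂ}
    (h1 : Integrable f) (h2 : MemLp f 2 (volume : Measure E)) (Φ : SchwartzMap E ℂ) :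
    ∫ x, Φ x • (𝓕 (h2.toLp f) : Lp ℂ 2 (volume : Measure E)) x = ∫ x, Φ x • 𝓕 f x := by
  have key := congrArg (fun T => T Φ) (Lp.fourier_toTemperedDistribution_eq (h2.toLp f))
  simp only [TemperedDistribution.fourier_apply, Lp.toTemperedDistribution_apply] at key
  rw [← key]
  have e1 : ∫ x, (𝓕 Φ) x • (h2.toLp f) x = ∫ x, (𝓕 Φ) x • f x := by
    refine integral_congr_ae ?_
    filter_upwards [h2.coeFn_toLp] with x hx
    rw [hx]
  rw [e1, SchwartzMap.fourier_coe]
  have := VectorFourier.integral_fourierIntegral_smul_eq_flip (L := innerₗ E) (f := (Φ : E → ℂ))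
    (g := f) (μ := volume) (ν := volume) Real.continuous_fourierChar continuous_inner Φ.integrable h1
  simpa [Real.fourier_eq] using! this

theorem fourier_toLp_ae_eq {E : Type*} [NormedAddCommGroup E] [InnerProductSpace ℝ E]
    [FiniteDimensional ℝ E] [MeasurableSpace E] [BorelSpace E] {f : E → ℂ}
    (h1 : Integrable f) (h2 : MemLp f 2 (volume : Measure E)) :
    (𝓕 (h2.toLp f) : Lp ℂ 2 (volume : Measure E)) =ᵐ[volume] 𝓕 f := by
  have hcont : Continuous (𝓕 f) := 
    VectorFourier.fourierIntegral_continuous (L := innerₗ E) (μ := volume)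
      Real.continuous_fourierChar continuous_inner h1
  refine ae_eq_of_integral_contDiff_smul_eq ?_ hcont.locallyIntegrable ?_
  · exact (Lp.memLp _).locallyIntegrable (by norm_num)
  · intro φ hφ hφc
    have hg₁ : HasCompactSupport (Complex.ofRealCLM ∘ φ) := hφc.comp_left rfl
    have hg₂ : ContDiff ℝ (↑(⊤ : ℕ∞)) (Complex.ofRealCLM ∘ φ) := by fun_prop
    have := integral_smul_fourier_toLp h1 h2 (hg₁.toSchwartzMap hg₂)
    simpa using this

/-- Plancherel for functions that are both integrable and square integrable. -/
theorem integral_fourier_mul_conj {E : Type*} [NormedAddCommGroup E] [InnerProductSpace ℝ E]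
    [FiniteDimensional ℝ E] [MeasurableSpace E] [BorelSpace E] {f h : E → ℂ}
    (hf1 : Integrable f) (hf2 : MemLp f 2 (volume : Measure E))
    (hh1 : Integrable h) (hh2 : MemLp h 2 (volume : Measure E)) :
    ∫ x, 𝓕 f x * (starRingEnd ℂ) (𝓕 h x) = ∫ x, f x * (starRingEnd ℂ) (h x) := by
  have key := Lp.inner_fourier_eq (hh2.toLp h) (hf2.toLp f)
  rw [L2.inner_def, L2.inner_def] at key
  have e1 : ∫ x, 𝓕 f x * (starRingEnd ℂ) (𝓕 h x)
      = ∫ x, inner ℂ ((𝓕 (hh2.toLp h) : Lp ℂ 2 (volume : Measure E)) x)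
        ((𝓕 (hf2.toLp f) : Lp ℂ 2 (volume : Measure E)) x) := by
    refine integral_congr_ae ?_
    filter_upwards [fourier_toLp_ae_eq hf1 hf2, fourier_toLp_ae_eq hh1 hh2] with x h1 h2
    rw [h1, h2]; simp
  rw [e1, key]
  refine integral_congr_ae ?_
  filter_upwards [hf2.coeFn_toLp, hh2.coeFn_toLp] with x h1 h2
  rw [h1, h2]; simp

theorem L2inner_tfShift {d : ℕ} (f h : Ed d → ℂ) (w : E2 d) :
    L2inner f (tfShift w h) =
      𝓕 (fun t => f t * (starRingEnd ℂ) (h (t - timePart w))) (freqPart w) := by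
  rw [Real.fourier_eq', L2inner]
  refine integral_congr_ae (Eventually.of_forall fun t => ?_)
  have : (∑ i : Fin d, ((freqPart w i : ℝ) : ℂ) * ((t i : ℝ) : ℂ))
      = ((inner ℝ t (freqPart w) : ℝ) : ℂ) := by
    simp [PiLp.inner_apply]
  simp only [tfShift, this, map_mul, ← Complex.exp_conj, smul_eq_mul]
  simp only [Complex.conj_I, Complex.conj_ofReal, map_ofNat]
  rw [show (2 * (Real.pi : ℂ) * -Complex.I * ((inner ℝ t (freqPart w) : ℝ) : ℂ)) =
    ((-2 * Real.pi * inner ℝ t (freqPart w) : ℝ) : ℂ) * Complex.I by push_cast; ring]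
  ring

theorem measurePreserving_timeFreq (d : ℕ) :
    MeasurePreserving (fun z : E2 d => (timePart z, freqPart z)) volume (volume.prod volume) := by
  have h1 := PiLp.volume_preserving_ofLp (Fin d ⊕ Fin d)
  have h2 := measurePreserving_sumPiEquivProdPi (fun _ : Fin d ⊕ Fin d => (volume : Measure ℝ))
  have h3 := (PiLp.volume_preserving_toLp (Fin d)).prod (PiLp.volume_preserving_toLp (Fin d))
  exact h3.comp (h2.comp h1)

theorem MeasureTheory.MemLp.integrable_mul_conj_shift {d : ℕ} {f h : Ed d → ℂ}
    (hf : MemLp f 2 (volume : Measure (Ed d))) (hh : MemLp h 2 (volume : Measure (Ed d)))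
    (x : Ed d) : Integrable (fun t => f t * (starRingEnd ℂ) (h (t - x))) := by
  have h1 : MemLp (fun t => (starRingEnd ℂ) (h (t - x))) 2 (volume : Measure (Ed d)) :=
    (hh.comp_measurePreserving (measurePreserving_sub_right volume x)).star
  exact hf.integrable_mul h1

theorem ae_memLp_mul_conj_shift {d : ℕ} {f h : Ed d → ℂ}
    (hf : MemLp f 2 (volume : Measure (Ed d))) (hh : MemLp h 2 (volume : Measure (Ed d))) :
    ∀ᵐ x : Ed d, MemLp (fun t => f t * (starRingEnd ℂ) (h (t - x))) 2
      (volume : Measure (Ed d)) := by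
  have i1 : Integrable (fun t => ‖f t‖ ^ 2) (volume : Measure (Ed d)) := hf.integrable_norm_pow (by norm_num)
  have i2 : Integrable (fun t => ‖h (-t)‖ ^ 2) (volume : Measure (Ed d)) :=
    Integrable.comp_neg (hh.integrable_norm_pow (by norm_num))
  filter_upwards [i1.ae_convolution_exists (L := ContinuousLinearMap.mul ℝ ℝ) i2] with x hx
  rw [memLp_two_iff_integrable_sq_norm (hf.integrable_mul_conj_shift hh x).aestronglyMeasurable]
  refine hx.congr (Eventually.of_forall fun t => ?_)
  simp [mul_pow]

theorem integral_integral_mul_shift {d : ℕ} {a b : Ed d → ℂ} (ha : Integrable a)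
    (hb : Integrable b) :
    ∫ x, ∫ t, a t * b (t - x) = (∫ t, a t) * ∫ t, b t := by
  have := integral_convolution (ContinuousLinearMap.mul ℝ ℂ) ha hb.comp_neg
    (μ := (volume : Measure (Ed d))) (ν := volume)
  rw [integral_neg_eq_self (f := b)] at this
  simpa [convolution_def] using this

theorem stronglyMeasurable_stft {d : ℕ} {f h : Ed d → ℂ} (hf : StronglyMeasurable f)
    (hh : StronglyMeasurable h) :
    StronglyMeasurable (fun p : Ed d × Ed d =>
      𝓕 (fun t => f t * (starRingEnd ℂ) (h (t - p.1))) p.2) := by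
  simp only [Real.fourier_eq']
  apply StronglyMeasurable.integral_prod_right'
    (f := fun q : (Ed d × Ed d) × Ed d => Complex.exp (↑(-2 * Real.pi * inner ℝ q.2 q.1.2) * Complex.I) •
        (f q.2 * (starRingEnd ℂ) (h (q.2 - q.1.1))))
  have hm := hf.measurable
  have hm' := hh.measurable
  refine Measurable.stronglyMeasurable ?_
  fun_prop

theorem stronglyMeasurable_L2inner_tfShift {d : ℕ} {f h : Ed d → ℂ} (hf : StronglyMeasurable f)
    (hh : StronglyMeasurable h) :
    StronglyMeasurable (fun w : E2 d => L2inner f (tfShift w h)) := by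
  rw [show (fun w : E2 d => L2inner f (tfShift w h)) =
      (fun p : Ed d × Ed d => 𝓕 (fun t => f t * (starRingEnd ℂ) (h (t - p.1))) p.2) ∘
        fun z : E2 d => (timePart z, freqPart z) from funext fun w => L2inner_tfShift f h w]
  exact (stronglyMeasurable_stft hf hh).comp_measurable (measurePreserving_timeFreq d).measurable

/-- The inequality form of Moyal's orthogonality relation for the short-time Fourier transform. -/
theorem enorm_L2inner_mul_le_lintegral {d : ℕ} {f₁ f₂ h₁ h₂ : Ed d → ℂ}
    (sf₁ : StronglyMeasurable f₁) (sf₂ : StronglyMeasurable f₂)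
    (sh₁ : StronglyMeasurable h₁) (sh₂ : StronglyMeasurable h₂)
    (hf₁ : MemLp f₁ 2 (volume : Measure (Ed d))) (hf₂ : MemLp f₂ 2 (volume : Measure (Ed d)))
    (hh₁ : MemLp h₁ 2 (volume : Measure (Ed d))) (hh₂ : MemLp h₂ 2 (volume : Measure (Ed d))) :
    ‖L2inner f₁ f₂‖ₑ * ‖L2inner h₁ h₂‖ₑ ≤
      ∫⁻ w : E2 d, ‖L2inner f₁ (tfShift w h₁)‖ₑ * ‖L2inner f₂ (tfShift w h₂)‖ₑ := by
  set V₁ : Ed d × Ed d → ℂ := fun p => 𝓕 (fun t => f₁ t * (starRingEnd ℂ) (h₁ (t - p.1))) p.2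
    with hV₁
  set V₂ : Ed d × Ed d → ℂ := fun p => 𝓕 (fun t => f₂ t * (starRingEnd ℂ) (h₂ (t - p.1))) p.2
    with hV₂
  have mV₁ : Measurable V₁ := (stronglyMeasurable_stft sf₁ sh₁).measurable
  have mV₂ : Measurable V₂ := (stronglyMeasurable_stft sf₂ sh₂).measurable
  have hR : ∫⁻ w : E2 d, ‖L2inner f₁ (tfShift w h₁)‖ₑ * ‖L2inner f₂ (tfShift w h₂)‖ₑ
      = ∫⁻ x, ∫⁻ ξ, ‖V₁ (x, ξ)‖ₑ * ‖V₂ (x, ξ)‖ₑ := by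
    simp only [L2inner_tfShift]
    rw [← lintegral_prod (fun p : Ed d × Ed d => ‖V₁ p‖ₑ * ‖V₂ p‖ₑ) (by fun_prop),
      ← (measurePreserving_timeFreq d).lintegral_comp (by fun_prop)]
  have ha : Integrable (fun t => f₁ t * (starRingEnd ℂ) (f₂ t)) := hf₁.integrable_mul hf₂.star
  have hb : Integrable (fun t => (starRingEnd ℂ) (h₁ t) * h₂ t) := hh₁.star.integrable_mul hh₂
  have hL : L2inner f₁ f₂ * (starRingEnd ℂ) (L2inner h₁ h₂)
      = ∫ x, ∫ ξ, V₁ (x, ξ) * (starRingEnd ℂ) (V₂ (x, ξ)) := by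
    have h1 := integral_integral_mul_shift ha hb
    rw [L2inner, L2inner, ← integral_conj]
    simp only [map_mul, Complex.conj_conj]
    rw [← h1]
    refine integral_congr_ae ?_
    filter_upwards [ae_memLp_mul_conj_shift hf₁ hh₁, ae_memLp_mul_conj_shift hf₂ hh₂] with x k1 k2
    have := integral_fourier_mul_conj (hf₁.integrable_mul_conj_shift hh₁ x) k1
      (hf₂.integrable_mul_conj_shift hh₂ x) k2
    simp only [hV₁, hV₂, this]
    refine integral_congr_ae (Eventually.of_forall fun t => ?_)
    simp only [map_mul, Complex.conj_conj]
    ring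
  calc ‖L2inner f₁ f₂‖ₑ * ‖L2inner h₁ h₂‖ₑ
      = ‖L2inner f₁ f₂ * (starRingEnd ℂ) (L2inner h₁ h₂)‖ₑ := by
        rw [enorm_mul]; congr 1; simp [← ofReal_norm]
    _ ≤ ∫⁻ x, ‖∫ ξ, V₁ (x, ξ) * (starRingEnd ℂ) (V₂ (x, ξ))‖ₑ := by
        rw [hL]; exact enorm_integral_le_lintegral_enorm _
    _ ≤ ∫⁻ x, ∫⁻ ξ, ‖V₁ (x, ξ)‖ₑ * ‖V₂ (x, ξ)‖ₑ := by
        refine lintegral_mono fun x => (enorm_integral_le_lintegral_enorm _).trans_eq ?_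
        refine lintegral_congr fun ξ => ?_
        rw [enorm_mul]; congr 1; simp [← ofReal_norm]
    _ = _ := hR.symm

theorem timePart_add {d : ℕ} (z w : E2 d) : timePart (z + w) = timePart z + timePart w := by
  ext i; simp [timePart]

theorem freqPart_add {d : ℕ} (z w : E2 d) : freqPart (z + w) = freqPart z + freqPart w := by
  ext i; simp [freqPart]

theorem tfShift_tfShift {d : ℕ} (w u : E2 d) (g : Ed d → ℂ) (t : Ed d) :
    tfShift w (tfShift u g) t =
      Complex.exp ((-2 * Real.pi * ∑ i, freqPart u i * timePart w i : ℝ) * Complex.I) *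
        tfShift (w + u) g t := by
  simp only [tfShift, timePart_add, freqPart_add, sub_sub]
  rw [← mul_assoc, ← mul_assoc, ← Complex.exp_add, ← Complex.exp_add]
  congr 2
  push_cast
  simp only [PiLp.add_apply, PiLp.sub_apply, Complex.ofReal_add, Complex.ofReal_sub, mul_sub,
    add_mul, Finset.sum_add_distrib, Finset.sum_sub_distrib]
  ring

theorem norm_tfShift {d : ℕ} (z : E2 d) (g : Ed d → ℂ) (t : Ed d) :
    ‖tfShift z g t‖ = ‖g (t - timePart z)‖ := by
  have : 2 * (Real.pi : ℂ) * Complex.I * (∑ i : Fin d, (freqPart z i : ℂ) * (t i : ℂ))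
      = ((2 * Real.pi * ∑ i : Fin d, freqPart z i * t i : ℝ) : ℂ) * Complex.I := by
    push_cast; ring
  rw [tfShift, this, norm_mul, Complex.norm_exp_ofReal_mul_I, one_mul]

theorem L2inner_tfShift_tfShift {d : ℕ} (z : E2 d) (f h : Ed d → ℂ) :
    L2inner (tfShift z f) (tfShift z h) = L2inner f h := by
  rw [L2inner, L2inner, ← integral_sub_right_eq_self (fun t => f t * (starRingEnd ℂ) (h t)) (timePart z)]
  refine integral_congr_ae (Eventually.of_forall fun t => ?_)
  have : 2 * (Real.pi : ℂ) * Complex.I * (∑ i : Fin d, (freqPart z i : ℂ) * (t i : ℂ))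
      = ((2 * Real.pi * ∑ i : Fin d, freqPart z i * t i : ℝ) : ℂ) * Complex.I := by
    push_cast; ring
  simp only [tfShift, this, map_mul]
  set e := Complex.exp (((2 * Real.pi * ∑ i : Fin d, freqPart z i * t i : ℝ) : ℂ) * Complex.I)
  have he : e * (starRingEnd ℂ) e = 1 := by
    rw [Complex.mul_conj, Complex.normSq_eq_norm_sq, Complex.norm_exp_ofReal_mul_I]; simp
  linear_combination (f (t - timePart z) * (starRingEnd ℂ) (h (t - timePart z))) * he

theorem norm_L2inner_tfShift_comp {d : ℕ} (w u : E2 d) (f g : Ed d → ℂ) :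
    ‖L2inner f (tfShift w (tfShift u g))‖ = ‖L2inner f (tfShift (w + u) g)‖ := by
  simp only [L2inner, tfShift_tfShift, map_mul]
  simp_rw [mul_left_comm _ ((starRingEnd ℂ) (Complex.exp _))]
  rw [integral_const_mul, norm_mul, RCLike.norm_conj, Complex.norm_exp_ofReal_mul_I, one_mul]

theorem norm_L2inner_shift_shift {d : ℕ} (z w : E2 d) (g : Ed d → ℂ) :
    ‖L2inner (tfShift z g) (tfShift w g)‖ = ‖L2inner g (tfShift (w - z) g)‖ := by
  rw [← L2inner_tfShift_tfShift z g, norm_L2inner_tfShift_comp, add_sub_cancel]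

theorem norm_L2inner_comm {d : ℕ} (f h : Ed d → ℂ) : ‖L2inner f h‖ = ‖L2inner h f‖ := by
  rw [L2inner, L2inner, ← RCLike.norm_conj, ← integral_conj]
  simp only [map_mul, RingHomCompTriple.comp_apply, RingHom.id_apply, mul_comm]

theorem norm_L2inner_tfShift_neg {d : ℕ} (z : E2 d) (g : Ed d → ℂ) :
    ‖L2inner g (tfShift (-z) g)‖ = ‖L2inner g (tfShift z g)‖ := by
  have h := norm_L2inner_shift_shift z 0 g
  have h' := norm_L2inner_shift_shift 0 z g
  rw [zero_sub] at h
  rw [sub_zero] at h'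
  rw [← h, ← h', norm_L2inner_comm]

theorem stronglyMeasurable_tfShift {d : ℕ} (z : E2 d) {g : Ed d → ℂ} (hg : StronglyMeasurable g) :
    StronglyMeasurable (tfShift z g) := by
  have := hg.measurable
  refine Measurable.stronglyMeasurable ?_
  unfold tfShift
  fun_prop

theorem tfShift_congr_ae {d : ℕ} (z : E2 d) {g g' : Ed d → ℂ} (h : g =ᵐ[volume] g') :
    tfShift z g =ᵐ[volume] tfShift z g' := by
  have := (measurePreserving_sub_right volume (timePart z)).quasiMeasurePreserving.ae_eq_comp h
  filter_upwards [this] with t ht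
  simp only [Function.comp_apply] at ht
  simp only [tfShift, ht]

theorem memLp_tfShift {d : ℕ} (z : E2 d) {g : Ed d → ℂ}
    (hg : MemLp g 2 (volume : Measure (Ed d))) :
    MemLp (tfShift z g) 2 (volume : Measure (Ed d)) := by
  have h1 := hg.comp_measurePreserving (measurePreserving_sub_right volume (timePart z))
  refine h1.of_le ?_ (Eventually.of_forall fun t => (norm_tfShift z g t).le)
  exact (stronglyMeasurable_tfShift z hg.1.stronglyMeasurable_mk).aestronglyMeasurable.congr
    (tfShift_congr_ae z hg.1.ae_eq_mk).symm

/-- The modulus of the ambiguity function `z ↦ ⟨g, π(z) g⟩`. -/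
def ambig {d : ℕ} (g : Ed d → ℂ) (z : E2 d) : ENNReal := ‖L2inner g (tfShift z g)‖ₑ

theorem ambig_congr_ae {d : ℕ} {g g' : Ed d → ℂ} (h : g =ᵐ[volume] g') : ambig g = ambig g' := by
  ext1 z
  unfold ambig L2inner
  congr 1
  refine integral_congr_ae ?_
  filter_upwards [h, tfShift_congr_ae z h] with t h1 h2
  rw [h1, h2]

theorem measurable_ambig {d : ℕ} {g : Ed d → ℂ} (hg : MemLp g 2 (volume : Measure (Ed d))) :
    Measurable (ambig g) := by
  rw [ambig_congr_ae hg.1.ae_eq_mk]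
  exact (stronglyMeasurable_L2inner_tfShift hg.1.stronglyMeasurable_mk
    hg.1.stronglyMeasurable_mk).measurable.enorm

theorem ambig_neg {d : ℕ} (g : Ed d → ℂ) (z : E2 d) : ambig g (-z) = ambig g z := by
  simp only [ambig, ← ofReal_norm, norm_L2inner_tfShift_neg]

theorem ambig_mul_le_lintegral {d : ℕ} {g : Ed d → ℂ} (hg : MemLp g 2 (volume : Measure (Ed d)))
    (z u : E2 d) : ambig g z * ambig g u ≤ ∫⁻ w, ambig g w * ambig g (w + u - z) := by
  have hm := hg.1.stronglyMeasurable_mk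
  rw [ambig_congr_ae hg.1.ae_eq_mk]
  have hg' := hg.ae_eq hg.1.ae_eq_mk
  set g' := hg.1.mk g
  refine (enorm_L2inner_mul_le_lintegral hm (stronglyMeasurable_tfShift z hm) hm
    (stronglyMeasurable_tfShift u hm) hg' (memLp_tfShift z hg') hg' (memLp_tfShift u hg')).trans_eq
    (lintegral_congr fun w => ?_)
  simp only [ambig, ← ofReal_norm, norm_L2inner_tfShift_comp, norm_L2inner_shift_shift]

theorem tsum_indicator_le_of_relativelySeparated {d : ℕ} {Λ : Set (E2 d)}
    (hΛ : RelativelySeparated Λ) (ρ : ℝ) :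
    ∃ N : ℕ, ∀ y : E2 d,
      ∑' l : Λ, (Metric.closedBall (0 : E2 d) ρ).indicator (1 : E2 d → ℝ≥0∞) (l - y) ≤ N := by
  obtain ⟨N, hN⟩ := hΛ
  obtain ⟨t, -, ht⟩ := (isCompact_closedBall (0 : E2 d) ρ).elim_finite_subcover_image
    (b := Set.univ) (c := fun c => Metric.ball c 1) (fun _ _ => Metric.isOpen_ball)
    (fun x _ => Set.mem_biUnion (Set.mem_univ x) (Metric.mem_ball_self one_pos))
  obtain ⟨tf, ht⟩ := ht
  lift t to Finset (E2 d) using tf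
  refine ⟨t.card * N, fun y => ?_⟩
  have h1 : ∀ c : E2 d,
      ∑' l : Λ, (Metric.ball c 1).indicator (1 : E2 d → ℝ≥0∞) (l - y) ≤ N := by
    intro c
    have e : ∀ l : Λ, (Metric.ball c 1).indicator (1 : E2 d → ℝ≥0∞) (l - y) ≤
        {l : E2 d | dist l (c + y) ≤ 1}.indicator 1 (l : E2 d) := by
      intro l
      by_cases hl : (l : E2 d) - y ∈ Metric.ball c 1
      · rw [Set.indicator_of_mem hl, Set.indicator_of_mem]
        · simp
        · rw [Set.mem_ofPred_eq, dist_eq_norm, add_comm, ← sub_sub, ← dist_eq_norm]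
          exact (Metric.mem_ball.1 hl).le
      · simp [Set.indicator_of_notMem hl]
    refine (ENNReal.tsum_le_tsum e).trans ?_
    rw [tsum_subtype Λ ({l : E2 d | dist l (c + y) ≤ 1}.indicator (1 : E2 d → ℝ≥0∞)),
      Set.indicator_indicator, ← tsum_subtype]
    simp only [Pi.one_apply, ENNReal.tsum_set_one]
    exact_mod_cast hN (c + y)
  calc _ ≤ ∑' l : Λ, ∑ c ∈ t, (Metric.ball c 1).indicator (1 : E2 d → ℝ≥0∞) (l - y) := by
        refine ENNReal.tsum_le_tsum fun l => ?_
        by_cases hl : (l : E2 d) - y ∈ Metric.closedBall (0 : E2 d) ρ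
        · obtain ⟨c, hc, hlc⟩ := Set.mem_iUnion₂.1 (ht hl)
          rw [Set.indicator_of_mem hl]
          refine le_trans ?_ (Finset.single_le_sum (fun _ _ => zero_le) hc)
          rw [Set.indicator_of_mem hlc]
        · simp [Set.indicator_of_notMem hl]
    _ = ∑ c ∈ t, ∑' l : Λ, (Metric.ball c 1).indicator (1 : E2 d → ℝ≥0∞) (l - y) :=
        Summable.tsum_finsetSum fun _ _ => ENNReal.summable
    _ ≤ ∑ c ∈ t, (N : ℝ≥0∞) := Finset.sum_le_sum fun c _ => h1 c
    _ = _ := by simp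

theorem finite_norm_le_of_relativelySeparated {d : ℕ} {Λ : Set (E2 d)}
    (hΛ : RelativelySeparated Λ) (ρ : ℝ) : {l : Λ | ‖(l : E2 d)‖ ≤ ρ}.Finite := by
  obtain ⟨N, hN⟩ := tsum_indicator_le_of_relativelySeparated hΛ ρ
  have h : ∑' l : Λ, {l : Λ | ‖(l : E2 d)‖ ≤ ρ}.indicator (1 : Λ → ℝ≥0∞) l ≤ N := by
    refine le_trans (le_of_eq (tsum_congr fun l => ?_)) (hN 0)
    simp [Set.indicator]
  rw [← tsum_subtype] at h
  simp only [Pi.one_apply, ENNReal.tsum_set_one] at h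
  refine Set.encard_lt_top_iff.1 (lt_of_le_of_lt (b := (N : ℕ∞)) (by exact_mod_cast h) ?_)
  exact ENat.natCast_lt_top N

theorem exists_setLIntegral_ambig_ne_zero {d : ℕ} {g : Ed d → ℂ}
    (hg : MemLp g 2 (volume : Measure (Ed d))) {z : E2 d} (hz : ambig g z ≠ 0) :
    ∃ n : ℕ, ∫⁻ u in Metric.closedBall (0 : E2 d) n, ambig g u ≠ 0 := by
  by_contra! h
  have hm := measurable_ambig hg
  have hae : ambig g =ᵐ[volume] 0 := by
    have h' : ∀ n : ℕ, ∀ᵐ u : E2 d, u ∈ Metric.closedBall (0 : E2 d) n → ambig g u = 0 := by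
      intro n
      have := (lintegral_eq_zero_iff hm).1 (h n)
      exact (ae_restrict_iff' Metric.isClosed_closedBall.measurableSet).1 this
    filter_upwards [ae_all_iff.2 h'] with u hu
    obtain ⟨n, hn⟩ := exists_nat_ge ‖u‖
    exact hu n (by simpa using hn)
  have := ambig_mul_le_lintegral hg z z
  have h0 : ∫⁻ w, ambig g w * ambig g (w + z - z) = 0 := by
    rw [lintegral_eq_zero_iff' (by simp only [add_sub_cancel_right]; fun_prop)]
    filter_upwards [hae] with w hw
    simp [hw]
  rw [h0] at this
  exact hz (by simpa using this)

/-- If the ambiguity function of `g` is integrable against a submultiplicative weight, then its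
samples on translates of a relatively separated set are uniformly summable against this weight. -/
theorem exists_tsum_ambig_mul_le {d : ℕ} {g : Ed d → ℂ}
    (hg : MemLp g 2 (volume : Measure (Ed d))) {v : E2 d → ℝ≥0∞} (hv : Measurable v)
    (hv1 : ∀ z, 1 ≤ v z) (hsub : ∀ z w u, v z ≤ v w * (v u * v (w + u - z)))
    (hbdd : ∀ n : ℕ, ∃ V : ℝ≥0∞, V ≠ ⊤ ∧ ∀ z ∈ Metric.closedBall (0 : E2 d) n, v z ≤ V)
    (hint : ∫⁻ z, ambig g z * v z ≠ ⊤) {Λ : Set (E2 d)} (hΛc : Λ.Countable)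
    (hΛ : RelativelySeparated Λ) :
    ∃ K : ℝ≥0∞, K ≠ ⊤ ∧ ∀ y : E2 d, ∑' l : Λ, ambig g (l - y) * v (l - y) ≤ K := by
  by_cases h0 : ∀ z, ambig g z = 0
  · exact ⟨0, by simp, fun y => by simp [h0]⟩
  push Not at h0
  obtain ⟨z₀, hz₀⟩ := h0
  obtain ⟨n, hn⟩ := exists_setLIntegral_ambig_ne_zero hg hz₀
  obtain ⟨V, hV, hVb⟩ := hbdd n
  obtain ⟨N, hN⟩ := tsum_indicator_le_of_relativelySeparated hΛ n
  have hm := measurable_ambig hg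
  have := hΛc.to_subtype
  set B := Metric.closedBall (0 : E2 d) n with hB
  have hBm : MeasurableSet B := Metric.isClosed_closedBall.measurableSet
  set κ := ∫⁻ u in B, ambig g u with hκ
  set h : E2 d → ℝ≥0∞ := fun z => ambig g z * v z with hh
  have hhm : Measurable h := by fun_prop
  set I := ∫⁻ z, h z with hI
  have hκt : κ ≠ ⊤ := by
    refine ne_top_of_le_ne_top hint ((setLIntegral_le_lintegral _ _).trans
      (lintegral_mono fun z => ?_))
    exact le_mul_of_one_le_right zero_le (hv1 z)
  set χ : E2 d → ℝ≥0∞ := B.indicator 1 with hχ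
  have hχm : Measurable χ := measurable_one.indicator hBm
  have hjoint : ∀ z : E2 d, Measurable fun w : E2 d => ∫⁻ y, χ (z - (w - y)) * h y := by
    intro z
    exact Measurable.lintegral_prod_right' (f := fun p : E2 d × E2 d => χ (z - (p.1 - p.2)) * h p.2)
      (by fun_prop)
  have hpt : ∀ z, κ * h z ≤ V * ∫⁻ w, h w * ∫⁻ y, χ (z - (w - y)) * h y := by
    intro z
    calc κ * h z = ∫⁻ u in B, ambig g z * ambig g u * v z := by
          rw [hκ, hh, ← lintegral_mul_const _ hm]
          exact lintegral_congr fun u => by ring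
      _ ≤ ∫⁻ u in B, ∫⁻ w, V * (h w * h (w + u - z)) := by
          refine setLIntegral_mono' hBm fun u hu => ?_
          refine (mul_le_mul_left (ambig_mul_le_lintegral hg z u) _).trans ?_
          rw [← lintegral_mul_const _ (by fun_prop)]
          refine lintegral_mono fun w => ?_
          calc ambig g w * ambig g (w + u - z) * v z
              ≤ ambig g w * ambig g (w + u - z) * (v w * (v u * v (w + u - z))) := by
                gcongr; exact hsub z w u
            _ ≤ ambig g w * ambig g (w + u - z) * (v w * (V * v (w + u - z))) := by
                gcongr; exact hVb u hu
            _ = _ := by simp only [hh]; ring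
      _ = ∫⁻ w, ∫⁻ u in B, V * (h w * h (w + u - z)) := by
          rw [lintegral_lintegral_swap]
          exact Measurable.aemeasurable (by fun_prop)
      _ = ∫⁻ w, V * (h w * ∫⁻ y, χ (z - (w - y)) * h y) := by
          refine lintegral_congr fun w => ?_
          rw [lintegral_const_mul _ (by fun_prop), lintegral_const_mul _ (by fun_prop)]
          congr 2
          rw [← lintegral_indicator hBm,
            ← lintegral_add_right_eq_self (fun y => χ (z - (w - y)) * h y) (w - z)]
          refine lintegral_congr fun u => ?_
          rw [show z - (w - (u + (w - z))) = u by abel, show u + (w - z) = w + u - z by abel, hχ]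
          by_cases hu : u ∈ B <;> simp [hu]
      _ = _ := lintegral_const_mul _ (hhm.mul (hjoint z))
  have hsum : ∀ y, κ * ∑' l : Λ, h (l - y) ≤ V * (N * (I * I)) := by
    intro y
    have hprod : ∀ z, Measurable fun w => h w * ∫⁻ x, χ (z - (w - x)) * h x :=
      fun z => hhm.mul (hjoint z)
    calc κ * ∑' l : Λ, h (l - y) = ∑' l : Λ, κ * h (l - y) := ENNReal.tsum_mul_left.symm
      _ ≤ ∑' l : Λ, V * ∫⁻ w, h w * ∫⁻ x, χ ((l - y) - (w - x)) * h x :=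
          ENNReal.tsum_le_tsum fun l => hpt _
      _ = V * ∫⁻ w, h w * ∫⁻ x, (∑' l : Λ, χ ((l - y) - (w - x))) * h x := by
          rw [ENNReal.tsum_mul_left, ← lintegral_tsum fun l : Λ =>
            (hprod (l - y)).aemeasurable]
          congr 1
          refine lintegral_congr fun w => ?_
          rw [ENNReal.tsum_mul_left, ← lintegral_tsum fun l =>
            Measurable.aemeasurable (by fun_prop)]
          simp only [ENNReal.tsum_mul_right]
      _ ≤ V * ∫⁻ w, h w * ∫⁻ x, N * h x := by
          gcongr with w x
          simp only [sub_sub]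
          exact hN _
      _ = _ := by
          rw [lintegral_const_mul _ hhm, lintegral_mul_const _ hhm]
          ring
  refine ⟨κ⁻¹ * (V * (N * (I * I))), ?_, fun y => ?_⟩
  · refine ENNReal.mul_ne_top (ENNReal.inv_ne_top.2 hn) (ENNReal.mul_ne_top hV
      (ENNReal.mul_ne_top (ENNReal.natCast_ne_top N) (ENNReal.mul_ne_top hint hint)))
  · rw [← ENNReal.mul_le_mul_iff_right hn hκt, ← mul_assoc, ENNReal.mul_inv_cancel hn hκt, one_mul]
    exact hsum y

section HilbertFrame

theorem ENNReal.sq_tsum_mul_le {ι : Type*} (m : ι → ℝ≥0∞) (y : ι → ℝ≥0) :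
    (∑' j, m j * y j) ^ 2 ≤ (∑' j, m j) * ∑' j, m j * (y j : ℝ≥0∞) ^ 2 := by
  have h2 : 2 * (∑' j, m j * y j) ^ 2 ≤ 2 * ((∑' j, m j) * ∑' j, m j * (y j : ℝ≥0∞) ^ 2) := by
    calc 2 * (∑' j, m j * y j) ^ 2
        = ∑' j, ∑' k, m j * m k * (2 * y j * y k : ℝ≥0) := by
          rw [sq, ← ENNReal.tsum_mul_right, ← ENNReal.tsum_mul_left]
          refine tsum_congr fun j => ?_
          rw [← ENNReal.tsum_mul_left, ← ENNReal.tsum_mul_left]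
          refine tsum_congr fun k => ?_
          push_cast
          ring
      _ ≤ ∑' j, ∑' k, m j * m k * (y j ^ 2 + y k ^ 2 : ℝ≥0) := by
          gcongr with j k
          exact two_mul_le_add_sq _ _
      _ = ∑' j, ∑' k, (m j * y j ^ 2 * m k + m j * (m k * y k ^ 2)) := by
          refine tsum_congr fun j => tsum_congr fun k => ?_
          push_cast
          ring
      _ = _ := by
          simp only [ENNReal.tsum_add, ENNReal.tsum_mul_left, ENNReal.tsum_mul_right]
          ring
  exact (ENNReal.mul_le_mul_iff_right two_ne_zero ENNReal.ofNat_ne_top).1 h2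

theorem lp.norm_sq_eq_tsum {ι : Type*} (x : lp (fun _ : ι => ℂ) 2) :
    ‖x‖ ^ 2 = ∑' i, ‖x i‖ ^ 2 := by
  simpa using lp.norm_rpow_eq_tsum (p := 2) (by simp) x

theorem lp.summable_norm_sq {ι : Type*} (x : lp (fun _ : ι => ℂ) 2) :
    Summable fun i => ‖x i‖ ^ 2 := by
  simpa using (lp.memℓp x).summable (by simp)

theorem lp.enorm_sq_eq_tsum {ι : Type*} (x : lp (fun _ : ι => ℂ) 2) :
    ‖x‖ₑ ^ 2 = ∑' i, (‖x i‖₊ : ℝ≥0∞) ^ 2 := by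
  rw [← ofReal_norm, ← ENNReal.ofReal_pow (norm_nonneg _), lp.norm_sq_eq_tsum,
    ENNReal.ofReal_tsum_of_nonneg (fun i => by positivity) (lp.summable_norm_sq x)]
  refine tsum_congr fun i => ?_
  rw [ENNReal.ofReal_pow (norm_nonneg _), ofReal_norm, enorm_eq_nnnorm]

/-- Schur's test on `ℓ²`. -/
theorem lp.exists_hasSum_of_schur {ι : Type*} {M : ι → ι → ℂ} {δ : ℝ≥0}
    (hrow : ∀ i, ∑' j, ‖M i j‖ₑ ≤ δ) (hcol : ∀ j, ∑' i, ‖M i j‖ₑ ≤ δ)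
    (y : lp (fun _ : ι => ℂ) 2) :
    ∃ z : lp (fun _ : ι => ℂ) 2, ‖z‖ ≤ δ * ‖y‖ ∧ ∀ i, HasSum (fun j => M i j * y j) (z i) := by
  have hs : ∀ i, Summable fun j => M i j * y j := by
    intro i
    have h1 : Summable fun j => ‖M i j‖ := by
      refine summable_of_sum_le (c := δ) (fun _ => norm_nonneg _) fun u => ?_
      have := (ENNReal.sum_le_tsum u).trans (hrow i)
      simp only [enorm_eq_nnnorm] at this
      have h' : ∑ j ∈ u, ‖M i j‖₊ ≤ δ := by exact_mod_cast this
      simpa using NNReal.coe_le_coe.2 h'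
    refine Summable.of_norm_bounded (h1.mul_right ‖y‖) fun j => ?_
    rw [norm_mul]
    gcongr
    exact lp.norm_apply_le_norm two_ne_zero y j
  have hi : ∀ i, ‖∑' j, M i j * y j‖ₑ ^ 2 ≤ δ * ∑' j, ‖M i j‖ₑ * (‖y j‖₊ : ℝ≥0∞) ^ 2 := by
    intro i
    calc ‖∑' j, M i j * y j‖ₑ ^ 2 ≤ (∑' j, ‖M i j‖ₑ * ‖y j‖₊) ^ 2 := by
          gcongr
          refine (enorm_tsum_le_tsum_enorm).trans (le_of_eq (tsum_congr fun j => ?_))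
          rw [enorm_mul, enorm_eq_nnnorm (y j)]
      _ ≤ _ := (ENNReal.sq_tsum_mul_le _ _).trans (mul_le_mul_left (hrow i) _)
  have hall : ∑' i, ‖∑' j, M i j * y j‖ₑ ^ 2 ≤ (δ * ‖y‖ₑ) ^ 2 := by
    calc ∑' i, ‖∑' j, M i j * y j‖ₑ ^ 2
        ≤ ∑' i, δ * ∑' j, ‖M i j‖ₑ * (‖y j‖₊ : ℝ≥0∞) ^ 2 := ENNReal.tsum_le_tsum hi
      _ = δ * ∑' j, (∑' i, ‖M i j‖ₑ) * (‖y j‖₊ : ℝ≥0∞) ^ 2 := by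
          rw [ENNReal.tsum_mul_left, ENNReal.tsum_comm]
          simp only [ENNReal.tsum_mul_right]
      _ ≤ δ * ∑' j, δ * (‖y j‖₊ : ℝ≥0∞) ^ 2 := by gcongr with j; exact hcol j
      _ = _ := by rw [ENNReal.tsum_mul_left, ← lp.enorm_sq_eq_tsum]; ring
  have hsum : ∀ u : Finset ι, ∑ i ∈ u, ‖∑' j, M i j * y j‖ ^ 2 ≤ (δ * ‖y‖) ^ 2 := by
    intro u
    have := (ENNReal.sum_le_tsum u).trans hall
    simp only [enorm_eq_nnnorm] at this
    have h' : ∑ i ∈ u, ‖∑' j, M i j * y j‖₊ ^ 2 ≤ (δ * ‖y‖₊) ^ 2 := by exact_mod_cast this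
    simpa using NNReal.coe_le_coe.2 h'
  have hmem : Memℓp (fun i => ∑' j, M i j * y j) 2 := by
    refine memℓp_gen' (C := (δ * ‖y‖) ^ 2) fun u => ?_
    simpa using hsum u
  refine ⟨⟨_, hmem⟩, ?_, fun i => (hs i).hasSum⟩
  refine lp.norm_le_of_forall_sum_le (by simp) (by positivity) fun u => ?_
  simpa using hsum u

variable {ι E : Type*} [NormedAddCommGroup E] [InnerProductSpace ℂ E]

/-- The analysis operator `f ↦ (⟪ψ i, f⟫)ᵢ` of a Bessel family. -/
def analysisCLM (ψ : ι → E) (B : ℝ) (hs : ∀ f, Summable fun i => ‖inner ℂ (ψ i) f‖ ^ 2)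
    (hB : ∀ f, ∑' i, ‖inner ℂ (ψ i) f‖ ^ 2 ≤ B * ‖f‖ ^ 2) :
    E →L[ℂ] lp (fun _ : ι => ℂ) 2 :=
  LinearMap.mkContinuous
    { toFun := fun f => ⟨fun i => inner ℂ (ψ i) f, by
        refine memℓp_gen ?_
        simpa using hs f⟩
      map_add' := fun f h => by ext i; exact inner_add_right _ _ _
      map_smul' := fun c f => by ext i; exact inner_smul_right _ _ _ }
    (√B) fun f => by
      refine le_trans (b := √(B * ‖f‖ ^ 2)) (Real.le_sqrt_of_sq_le ?_) (le_of_eq ?_)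
      · rw [lp.norm_sq_eq_tsum]
        exact hB f
      · rw [Real.sqrt_mul' _ (by positivity), Real.sqrt_sq (norm_nonneg _)]

theorem analysisCLM_apply (ψ : ι → E) (B : ℝ)
    (hs : ∀ f, Summable fun i => ‖inner ℂ (ψ i) f‖ ^ 2)
    (hB : ∀ f, ∑' i, ‖inner ℂ (ψ i) f‖ ^ 2 ≤ B * ‖f‖ ^ 2) (f : E) (i : ι) :
    analysisCLM ψ B hs hB f i = inner ℂ (ψ i) f := rfl

theorem norm_analysisCLM_sq_le (ψ : ι → E) {B : ℝ} (hB0 : 0 ≤ B)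
    (hs : ∀ f, Summable fun i => ‖inner ℂ (ψ i) f‖ ^ 2)
    (hB : ∀ f, ∑' i, ‖inner ℂ (ψ i) f‖ ^ 2 ≤ B * ‖f‖ ^ 2) :
    ‖analysisCLM ψ B hs hB‖ ^ 2 ≤ B := by
  have : ‖analysisCLM ψ B hs hB‖ ≤ √B := LinearMap.mkContinuous_norm_le _ (Real.sqrt_nonneg _) _
  calc _ ≤ √B ^ 2 := by gcongr
    _ = B := Real.sq_sqrt hB0

end HilbertFrame

open ContinuousLinearMap in
theorem norm_sub_smul_adjoint_apply_sq_le {E H : Type*} [NormedAddCommGroup E]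
    [InnerProductSpace ℂ E] [CompleteSpace E] [NormedAddCommGroup H] [InnerProductSpace ℂ H]
    [CompleteSpace H] (C : E →L[ℂ] H) {B : ℝ} (hB : 0 < B) (hC : ‖C‖ ^ 2 ≤ B) (f : E) :
    ‖f - ((B⁻¹ : ℝ) : ℂ) • adjoint C (C f)‖ ^ 2 ≤ ‖f‖ ^ 2 - B⁻¹ * ‖C f‖ ^ 2 := by
  have h1 : ‖adjoint C (C f)‖ ^ 2 ≤ B * ‖C f‖ ^ 2 := by
    have := (adjoint C).le_opNorm (C f)
    rw [LinearIsometryEquiv.norm_map] at this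
    calc _ ≤ (‖C‖ * ‖C f‖) ^ 2 := by gcongr
      _ = ‖C‖ ^ 2 * ‖C f‖ ^ 2 := by ring
      _ ≤ _ := by gcongr
  have h2 : B⁻¹ ^ 2 * ‖adjoint C (C f)‖ ^ 2 ≤ B⁻¹ * ‖C f‖ ^ 2 := by
    calc _ ≤ B⁻¹ ^ 2 * (B * ‖C f‖ ^ 2) := by gcongr
      _ = _ := by field_simp
  rw [@norm_sub_sq ℂ, inner_smul_right, adjoint_inner_right, inner_self_eq_norm_sq_to_K, norm_smul,
    mul_pow]
  have h3 : RCLike.re (((B⁻¹ : ℝ) : ℂ) * ((‖C f‖ : ℝ) : ℂ) ^ 2) = B⁻¹ * ‖C f‖ ^ 2 := by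
    rw [← Complex.ofReal_pow, ← Complex.ofReal_mul]
    exact Complex.ofReal_re _
  rw [show RCLike.re (((B⁻¹ : ℝ) : ℂ) * (RCLike.ofReal ‖C f‖) ^ 2) = B⁻¹ * ‖C f‖ ^ 2 from h3,
    Complex.norm_real, Real.norm_of_nonneg (by positivity)]
  linarith

section FrameDecay

variable {ι E : Type*} [NormedAddCommGroup E] [InnerProductSpace ℂ E] [CompleteSpace E]

open ContinuousLinearMap

theorem adjoint_analysisCLM_single [DecidableEq ι] (ψ : ι → E) (B : ℝ)
    (hs : ∀ f, Summable fun i => ‖inner ℂ (ψ i) f‖ ^ 2)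
    (hB : ∀ f, ∑' i, ‖inner ℂ (ψ i) f‖ ^ 2 ≤ B * ‖f‖ ^ 2) (i : ι) (c : ℂ) :
    adjoint (analysisCLM ψ B hs hB) (lp.single 2 i c) = c • ψ i := by
  refine ext_inner_left ℂ fun f => ?_
  rw [adjoint_inner_right, lp.inner_single_right, analysisCLM_apply, inner_smul_right]
  simp

theorem hasSum_adjoint_analysisCLM (ψ : ι → E) (B : ℝ)
    (hs : ∀ f, Summable fun i => ‖inner ℂ (ψ i) f‖ ^ 2)
    (hB : ∀ f, ∑' i, ‖inner ℂ (ψ i) f‖ ^ 2 ≤ B * ‖f‖ ^ 2) (x : lp (fun _ : ι => ℂ) 2) :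
    HasSum (fun i => x i • ψ i) (adjoint (analysisCLM ψ B hs hB) x) := by
  classical
  have := (lp.hasSum_single (by simp) x).mapL (adjoint (analysisCLM ψ B hs hB))
  simpa only [adjoint_analysisCLM_single] using this

/-- If a frame has a redundancy witnessed by `p`, and its Gram matrix is a small perturbation of
itself after conjugation with the weight `exp φ`, then finite sections containing all indices of
small weight are nearly linearly dependent. -/
theorem exists_finset_sum_norm_le (ψ : ι → E) {A B : ℝ} (hB0 : 0 < B)
    (hs : ∀ f, Summable fun i => ‖inner ℂ (ψ i) f‖ ^ 2)
    (hA : ∀ f, A * ‖f‖ ^ 2 ≤ ∑' i, ‖inner ℂ (ψ i) f‖ ^ 2)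
    (hB : ∀ f, ∑' i, ‖inner ℂ (ψ i) f‖ ^ 2 ≤ B * ‖f‖ ^ 2)
    {q : ℝ} (hq0 : 0 ≤ q) (hq : 1 - B⁻¹ * A ≤ q ^ 2) (φ : ι → ℝ) (δ : ℝ≥0)
    (hrow : ∀ i, ∑' j,
      ‖((B⁻¹ : ℝ) : ℂ) * inner ℂ (ψ i) (ψ j) * (Real.exp (φ i - φ j) - 1 : ℝ)‖ₑ ≤ δ)
    (hcol : ∀ j, ∑' i,
      ‖((B⁻¹ : ℝ) : ℂ) * inner ℂ (ψ i) (ψ j) * (Real.exp (φ i - φ j) - 1 : ℝ)‖ₑ ≤ δ)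
    (p : lp (fun _ : ι => ℂ) 2) (hp : HasSum (fun i => p i • ψ i) 0) (k : ι) (m : ℕ)
    (s : Finset ι) (Φ : ℝ) (hΦ : ∀ i, i ∉ s → Φ ≤ φ i) :
    ∃ c : ι → ℂ,
      ‖∑ i ∈ s, c i • ψ i‖ ≤ q ^ m * ‖ψ k‖ + √B * (Real.exp (φ k - Φ) * (1 + δ) ^ m) ∧
      ‖p k‖ ≤ ‖p‖ * (√(∑ i ∈ s, ‖c i‖ ^ 2) + Real.exp (φ k - Φ) * (1 + δ) ^ m) := by
  classical
  set C := analysisCLM ψ B hs hB with hCdef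
  have hCn : ‖C‖ ^ 2 ≤ B := norm_analysisCLM_sq_le ψ hB0.le hs hB
  set D := adjoint C with hDdef
  have hDn : ‖D‖ ^ 2 ≤ B := by rwa [hDdef, LinearIsometryEquiv.norm_map]
  have hDC : adjoint D = C := adjoint_adjoint C
  have hDsum : ∀ x, HasSum (fun i => x i • ψ i) (D x) := hasSum_adjoint_analysisCLM ψ B hs hB
  have hDp : D p = 0 := (hDsum p).unique hp
  set β : ℂ := ((B⁻¹ : ℝ) : ℂ) with hβ
  set T : lp (fun _ : ι => ℂ) 2 → lp (fun _ : ι => ℂ) 2 := fun x => x - β • C (D x) with hT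
  have hTn : ∀ x, ‖T x‖ ≤ ‖x‖ := by
    intro x
    have := norm_sub_smul_adjoint_apply_sq_le D hB0 hDn x
    rw [hDC] at this
    refine le_of_sq_le_sq (this.trans ?_) (norm_nonneg _)
    have : 0 ≤ B⁻¹ * ‖D x‖ ^ 2 := by positivity
    linarith
  have hPn : ∀ f, ‖f - β • D (C f)‖ ≤ q * ‖f‖ := by
    intro f
    have h1 := norm_sub_smul_adjoint_apply_sq_le C hB0 hCn f
    have h2 : A * ‖f‖ ^ 2 ≤ ‖C f‖ ^ 2 := by rw [lp.norm_sq_eq_tsum]; exact hA f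
    refine le_of_sq_le_sq (h1.trans ?_) (by positivity)
    have h3 : B⁻¹ * (A * ‖f‖ ^ 2) ≤ B⁻¹ * ‖C f‖ ^ 2 := by gcongr
    have h4 : (1 - B⁻¹ * A) * ‖f‖ ^ 2 ≤ q ^ 2 * ‖f‖ ^ 2 := by gcongr
    nlinarith
  set e : lp (fun _ : ι => ℂ) 2 := lp.single 2 k (1 : ℂ) with he
  set x : ℕ → lp (fun _ : ι => ℂ) 2 := fun m => T^[m] e with hx
  have hxs : ∀ m, x (m + 1) = T (x m) := fun m => Function.iterate_succ_apply' T m e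
  have hDx : ∀ m, ‖D (x m)‖ ≤ q ^ m * ‖ψ k‖ := by
    intro m
    induction m with
    | zero =>
      have : D e = ψ k := by
        rw [hDdef, hCdef, he, adjoint_analysisCLM_single, one_smul]
      simp [hx, this]
    | succ m ih =>
      have : D (x (m + 1)) = D (x m) - β • D (C (D (x m))) := by
        rw [hxs, hT]; simp
      rw [this, pow_succ']
      refine (hPn _).trans ?_
      rw [mul_assoc]
      gcongr
  have hxp : ∀ m, inner ℂ (x m) p = p k := by
    intro m
    induction m with
    | zero => simp [hx, he, lp.inner_single_left]
    | succ m ih =>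
      rw [hxs, hT, inner_sub_left, ih, inner_smul_left, ← hDC, adjoint_inner_left, hDp]
      simp
  have hxy : ∀ m, ∃ y : lp (fun _ : ι => ℂ) 2, ‖y‖ ≤ (1 + δ) ^ m ∧
      ∀ i, x m i = (Real.exp (φ k - φ i) : ℝ) * y i := by
    intro m
    induction m with
    | zero =>
      refine ⟨e, by simp [he], fun i => ?_⟩
      by_cases hi : i = k
      · subst hi; simp [hx]
      · simp [hx, he, Pi.single_eq_of_ne hi]
    | succ m ih =>
      obtain ⟨y, hy, hyx⟩ := ih
      obtain ⟨z, hz, hzs⟩ := lp.exists_hasSum_of_schur hrow hcol y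
      refine ⟨T y - z, ?_, fun i => ?_⟩
      · calc ‖T y - z‖ ≤ ‖T y‖ + ‖z‖ := norm_sub_le _ _
          _ ≤ ‖y‖ + δ * ‖y‖ := add_le_add (hTn y) hz
          _ = (1 + δ) * ‖y‖ := by ring
          _ ≤ (1 + δ) * (1 + δ) ^ m := by gcongr
          _ = _ := by ring
      · have hG : ∀ w : lp (fun _ : ι => ℂ) 2,
            HasSum (fun j => β * (inner ℂ (ψ i) (ψ j) * w j)) ((β • C (D w)) i) := by
          intro w
          have := ((hDsum w).mapL (innerSL ℂ (ψ i))).mul_left β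
          simp only [innerSL_apply_apply, inner_smul_right] at this
          have hi : (β • C (D w)) i = β * inner ℂ (ψ i) (D w) := rfl
          rw [hi]
          refine this.congr_fun fun j => ?_
          ring
        have h1 := (((hG y).add (hzs i)).mul_left ((Real.exp (φ k - φ i) : ℝ) : ℂ))
        have h2 := hG (x m)
        have h3 : (β • C (D (x m))) i
            = (Real.exp (φ k - φ i) : ℝ) * ((β • C (D y)) i + z i) := by
          refine h2.unique (h1.congr_fun fun j => ?_)
          rw [hyx j]
          have : Real.exp (φ k - φ j) = Real.exp (φ k - φ i) * Real.exp (φ i - φ j) := by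
            rw [← Real.exp_add]; congr 1; ring
          rw [this]
          push_cast
          ring
        rw [hxs, hT]
        simp only [lp.coeFn_sub, Pi.sub_apply]
        rw [h3, hyx i]
        ring
  obtain ⟨y, hy, hyx⟩ := hxy m
  set X : lp (fun _ : ι => ℂ) 2 := ∑ i ∈ s, lp.single 2 i (x m i) with hX
  have hXD : D X = ∑ i ∈ s, x m i • ψ i := by
    rw [hX, map_sum]
    exact Finset.sum_congr rfl fun i _ => adjoint_analysisCLM_single ψ B hs hB i _
  have hXn : ‖X‖ = √(∑ i ∈ s, ‖x m i‖ ^ 2) := by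
    have := lp.norm_sum_single (p := 2) (by simp) (fun i => x m i) s
    simp only [ENNReal.toReal_ofNat, Real.rpow_ofNat] at this
    rw [← this, Real.sqrt_sq (norm_nonneg _)]
  set τ := Real.exp (φ k - Φ) * (1 + δ) ^ m with hτ
  have htail : ‖x m - X‖ ≤ τ := by
    have : ‖x m - X‖ ≤ ‖((Real.exp (φ k - Φ) : ℝ) : ℂ) • y‖ := by
      refine lp.norm_mono two_ne_zero fun i => ?_
      have hXi : X i = if i ∈ s then x m i else 0 := by
        rw [hX, lp.coeFn_sum, Finset.sum_apply]
        simp [Pi.single_apply]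
      rw [lp.coeFn_sub, Pi.sub_apply, hXi]
      by_cases hi : i ∈ s
      · simp [hi]
      · rw [if_neg hi, sub_zero, hyx i, lp.coeFn_smul, Pi.smul_apply, smul_eq_mul, norm_mul,
          norm_mul, Complex.norm_real, Complex.norm_real, Real.norm_of_nonneg (by positivity),
          Real.norm_of_nonneg (by positivity)]
        gcongr
        exact hΦ i hi
    refine this.trans ?_
    rw [norm_smul, Complex.norm_real, Real.norm_of_nonneg (by positivity), hτ]
    gcongr
  refine ⟨fun i => x m i, ?_, ?_⟩
  · rw [← hXD]
    calc ‖D X‖ = ‖D (x m) - D (x m - X)‖ := by rw [map_sub, sub_sub_cancel]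
      _ ≤ ‖D (x m)‖ + ‖D (x m - X)‖ := norm_sub_le _ _
      _ ≤ q ^ m * ‖ψ k‖ + √B * τ := by
        refine add_le_add (hDx m) ((D.le_opNorm _).trans ?_)
        gcongr
        exact Real.le_sqrt_of_sq_le hDn
  · rw [← hXn]
    calc ‖p k‖ = ‖inner ℂ (x m) p‖ := by rw [hxp]
      _ ≤ ‖x m‖ * ‖p‖ := norm_inner_le_norm _ _
      _ ≤ (‖X‖ + ‖x m - X‖) * ‖p‖ := by
        gcongr
        exact norm_le_norm_add_norm_sub' _ _
      _ ≤ (‖X‖ + τ) * ‖p‖ := by gcongr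
      _ = _ := mul_comm _ _

end FrameDecay

theorem Real.rpow_sub_rpow_le {b s t R : ℝ} (hb0 : 0 < b) (hb1 : b < 1) (hR : 0 < R) (hRs : R ≤ s)
    (hst : s ≤ t) : t ^ b - s ^ b ≤ (t - s) ^ b ∧ t ^ b - s ^ b ≤ R ^ (b - 1) * (t - s) := by
  have hs : 0 < s := hR.trans_le hRs
  have ht : 0 < t := hs.trans_le hst
  constructor
  · have := Real.rpow_add_le_add_rpow (sub_nonneg.2 hst) hs.le hb0.le hb1.le
    rw [sub_add_cancel] at this
    linarith
  · have h1 : s ^ (b - 1) ≤ R ^ (b - 1) :=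
      Real.rpow_le_rpow_of_nonpos hR hRs (by linarith)
    have h2 : t ^ (b - 1) ≤ s ^ (b - 1) :=
      Real.rpow_le_rpow_of_nonpos hs hst (by linarith)
    have h3 : t ^ b = t ^ (b - 1) * t := by
      rw [← Real.rpow_add_one ht.ne', sub_add_cancel]
    have h4 : s ^ b = s ^ (b - 1) * s := by
      rw [← Real.rpow_add_one hs.ne', sub_add_cancel]
    calc t ^ b - s ^ b ≤ s ^ (b - 1) * t - s ^ (b - 1) * s := by rw [h3, h4]; gcongr
      _ = s ^ (b - 1) * (t - s) := by ring
      _ ≤ _ := by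
        have := sub_nonneg.2 hst
        gcongr

theorem Real.abs_exp_sub_one_le_exp_abs (x : ℝ) : |Real.exp x - 1| ≤ Real.exp |x| - 1 := by
  have h1 := Real.add_one_le_exp x
  have h2 := Real.add_one_le_exp |x|
  have h3 := Real.exp_le_exp.2 (le_abs_self x)
  have h4 := neg_abs_le x
  rw [abs_le]
  constructor
  · linarith
  · linarith

/-- The slowly varying weights `α * max s R ^ b`: for large `R`, they are almost constant when
measured against `exp (a * ρ ^ b)`. -/
theorem exists_abs_exp_rpow_max_sub_one_le {a b α ε : ℝ} (hb0 : 0 < b) (hb1 : b < 1) (hα : 0 < α)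
    (hαa : α < a) (hε : 0 < ε) :
    ∃ R : ℝ, 0 < R ∧ ∀ s t ρ : ℝ, |s - t| ≤ ρ →
      |Real.exp (α * max s R ^ b - α * max t R ^ b) - 1| ≤ ε * Real.exp (a * ρ ^ b) := by
  obtain ⟨r, hr0, hr⟩ : ∃ r : ℝ, 0 ≤ r ∧ ∀ ρ, r ≤ ρ → Real.exp (-((a - α) * ρ ^ b)) ≤ ε := by
    have h1 : Tendsto (fun ρ : ℝ => Real.exp (-((a - α) * ρ ^ b))) atTop (nhds 0) :=
      Real.tendsto_exp_neg_atTop_nhds_zero.comp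
        ((tendsto_rpow_atTop hb0).const_mul_atTop (sub_pos.2 hαa))
    obtain ⟨r, hr⟩ := eventually_atTop.1 (h1.eventually_le_const hε)
    exact ⟨max r 0, le_max_right _ _, fun ρ hρ => hr ρ ((le_max_left _ _).trans hρ)⟩
  obtain ⟨R, hR, hR0⟩ : ∃ R : ℝ, Real.exp (α * (R ^ (b - 1) * r)) - 1 ≤ ε ∧ 0 < R := by
    have h1 : Tendsto (fun R : ℝ => R ^ (b - 1)) atTop (nhds 0) := by
      simpa using tendsto_rpow_neg_atTop (sub_pos.2 hb1)
    have h2 : Tendsto (fun R : ℝ => Real.exp (α * (R ^ (b - 1) * r)) - 1) atTop (nhds 0) := by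
      have := (((h1.mul_const r).const_mul α).rexp).sub_const 1
      simpa using this
    exact ((h2.eventually_le_const hε).and (eventually_gt_atTop 0)).exists
  refine ⟨R, hR0, fun s t ρ hρ => ?_⟩
  have hρ0 : 0 ≤ ρ := (abs_nonneg _).trans hρ
  have key : |max s R ^ b - max t R ^ b| ≤ ρ ^ b ∧
      |max s R ^ b - max t R ^ b| ≤ R ^ (b - 1) * ρ := by
    have hd : |max s R - max t R| ≤ ρ := (abs_max_sub_max_le_abs s t R).trans hρ
    have aux : ∀ x y : ℝ, R ≤ x → x ≤ y → y - x ≤ ρ → |y ^ b - x ^ b| ≤ ρ ^ b ∧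
        |y ^ b - x ^ b| ≤ R ^ (b - 1) * ρ := by
      intro x y hx hxy hyx
      have h := Real.rpow_sub_rpow_le hb0 hb1 hR0 hx hxy
      have hx0 : 0 < x := hR0.trans_le hx
      have hxy0 := sub_nonneg.2 hxy
      rw [abs_of_nonneg (sub_nonneg.2 (Real.rpow_le_rpow hx0.le hxy hb0.le))]
      exact ⟨h.1.trans (by gcongr), h.2.trans (by gcongr)⟩
    rcases le_total (max s R) (max t R) with h | h
    · rw [abs_sub_comm]
      exact aux _ _ (le_max_right _ _) h ((neg_sub _ _).symm.le.trans ((neg_le_abs _).trans hd))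
    · exact aux _ _ (le_max_right _ _) h ((le_abs_self _).trans hd)
  refine (Real.abs_exp_sub_one_le_exp_abs _).trans ?_
  rw [← mul_sub, abs_mul, abs_of_pos hα]
  rcases le_total ρ r with h | h
  · calc _ ≤ Real.exp (α * (R ^ (b - 1) * r)) - 1 := by
          gcongr
          exact key.2.trans (by gcongr)
      _ ≤ ε * 1 := by rwa [mul_one]
      _ ≤ _ := by
          gcongr
          exact Real.one_le_exp (by have := hα.trans hαa; positivity)
  · calc _ ≤ Real.exp (α * ρ ^ b) - 1 := by gcongr; exact key.1
      _ ≤ Real.exp (α * ρ ^ b) := by linarith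
      _ = Real.exp (-((a - α) * ρ ^ b)) * Real.exp (a * ρ ^ b) := by
          rw [← Real.exp_add]; congr 1; ring
      _ ≤ _ := by gcongr; exact hr ρ h

theorem L2inner_eq_inner_toLp {d : ℕ} {f h : Ed d → ℂ} (hf : MemLp f 2 (volume : Measure (Ed d)))
    (hh : MemLp h 2 (volume : Measure (Ed d))) :
    L2inner f h = inner ℂ (hh.toLp h) (hf.toLp f) := by
  rw [L2.inner_def, L2inner]
  refine integral_congr_ae ?_
  filter_upwards [hf.coeFn_toLp, hh.coeFn_toLp] with t h1 h2
  rw [h1, h2, RCLike.inner_apply]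

theorem integral_norm_sq_eq_norm_toLp_sq {d : ℕ} {f : Ed d → ℂ}
    (hf : MemLp f 2 (volume : Measure (Ed d))) :
    ∫ t, ‖f t‖ ^ 2 = ‖hf.toLp f‖ ^ 2 := by
  have h := L2inner_eq_inner_toLp hf hf
  rw [inner_self_eq_norm_sq_to_K, L2inner] at h
  have h2 : ∀ t, f t * (starRingEnd ℂ) (f t) = ((‖f t‖ ^ 2 : ℝ) : ℂ) := by
    intro t
    rw [Complex.mul_conj, Complex.normSq_eq_norm_sq]
  simp only [h2, integral_complex_ofReal] at h
  exact Complex.ofReal_injective (h.trans (Complex.ofReal_pow _ _).symm)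

/-- The time-frequency shift `π(z) g` as an element of `L²`. -/
def tfLp {d : ℕ} {g : Ed d → ℂ} (hg : MemLp g 2 (volume : Measure (Ed d))) (z : E2 d) :
    Lp ℂ 2 (volume : Measure (Ed d)) := (memLp_tfShift z hg).toLp _

theorem integral_norm_sum_tfShift_sq {d : ℕ} {g : Ed d → ℂ}
    (hg : MemLp g 2 (volume : Measure (Ed d))) {Λ : Set (E2 d)} (s : Finset Λ) (c : Λ → ℂ) :
    ∫ t : Ed d, ‖∑ l ∈ s, c l * tfShift (l : E2 d) g t‖ ^ 2
      = ‖∑ l ∈ s, c l • tfLp hg (l : E2 d)‖ ^ 2 := by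
  have hm : MemLp (fun t => ∑ l ∈ s, c l * tfShift (l : E2 d) g t) 2
      (volume : Measure (Ed d)) :=
    memLp_finsetSum s fun l _ => (memLp_tfShift (l : E2 d) hg).const_mul (c l)
  rw [integral_norm_sq_eq_norm_toLp_sq hm]
  congr 2
  refine Lp.ext ?_
  have h1 : ∀ᵐ t, ∀ l ∈ s, (c l • tfLp hg (l : E2 d) : Lp ℂ 2 (volume : Measure (Ed d))) t
      = c l * tfShift (l : E2 d) g t := by
    refine (ae_ball_iff s.countable_toSet).2 fun l _ => ?_
    filter_upwards [Lp.coeFn_smul (c l) (tfLp hg (l : E2 d)),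
      (memLp_tfShift (l : E2 d) hg).coeFn_toLp] with t h1 h2
    rw [h1, Pi.smul_apply, tfLp, h2, smul_eq_mul]
  filter_upwards [hm.coeFn_toLp, h1, Lp.coeFn_finsetSum s fun l => c l • tfLp hg (l : E2 d)]
    with t h1 h2 h3
  rw [h1, h3, Finset.sum_apply]
  exact Finset.sum_congr rfl fun l hl => (h2 l hl).symm

theorem norm_tfLp {d : ℕ} {g : Ed d → ℂ} (hg : MemLp g 2 (volume : Measure (Ed d))) (z : E2 d) :
    ‖tfLp hg z‖ ^ 2 = L2normSq g := by
  rw [tfLp, ← integral_norm_sq_eq_norm_toLp_sq]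
  simp only [norm_tfShift]
  exact integral_sub_right_eq_self (fun t => ‖g t‖ ^ 2) (timePart z)

theorem enorm_inner_tfLp {d : ℕ} {g : Ed d → ℂ} (hg : MemLp g 2 (volume : Measure (Ed d)))
    (z w : E2 d) : ‖inner ℂ (tfLp hg z) (tfLp hg w)‖ₑ = ambig g (z - w) := by
  rw [tfLp, tfLp, ← L2inner_eq_inner_toLp, ambig, ← ofReal_norm, norm_L2inner_shift_shift,
    ofReal_norm]

theorem lowerRiesz_le_div {d : ℕ} {g : Ed d → ℂ} (hg : MemLp g 2 (volume : Measure (Ed d)))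
    {Λ : Set (E2 d)} {n : ℕ} (s : Finset Λ) (c : Λ → ℂ) (hs : ∀ l ∈ s, ‖(l : E2 d)‖ ≤ (n : ℝ))
    (hc : 0 < ∑ l ∈ s, ‖c l‖ ^ 2) :
    lowerRiesz g Λ n ≤ ‖∑ l ∈ s, c l • tfLp hg (l : E2 d)‖ ^ 2 / ∑ l ∈ s, ‖c l‖ ^ 2 := by
  refine csInf_le ⟨0, ?_⟩ ⟨s, c, hs, hc, ?_⟩
  · rintro r ⟨s, c, -, hc, rfl⟩
    have := integral_nonneg (μ := (volume : Measure (Ed d)))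
      (f := fun t => ‖∑ l ∈ s, c l * tfShift (l : E2 d) g t‖ ^ 2) fun t => by positivity
    positivity
  · rw [integral_norm_sum_tfShift_sq hg]

theorem lowerRiesz_le_L2normSq {d : ℕ} {g : Ed d → ℂ} (hg : MemLp g 2 (volume : Measure (Ed d)))
    (Λ : Set (E2 d)) (n : ℕ) : lowerRiesz g Λ n ≤ L2normSq g := by
  by_cases h : ∃ l : Λ, ‖(l : E2 d)‖ ≤ n
  · obtain ⟨l, hl⟩ := h
    have := lowerRiesz_le_div hg (Λ := Λ) (n := n) {l} 1 (by simpa using hl) (by simp)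
    simpa [norm_tfLp hg] using this
  · push Not at h
    have h0 : 0 ≤ L2normSq g := integral_nonneg fun t => by positivity
    rw [lowerRiesz]
    convert h0
    convert Real.sInf_empty
    refine Set.eq_empty_of_forall_notMem ?_
    rintro r ⟨s, c, hs, hc, -⟩
    obtain ⟨l, hl⟩ : s.Nonempty := by
      rw [Finset.nonempty_iff_ne_empty]
      rintro rfl
      simp at hc
    exact absurd (hs l hl) (not_le.2 (h l))

theorem hasSum_tfLp_of_inSynthKernel {d : ℕ} {g : Ed d → ℂ}
    (hg : MemLp g 2 (volume : Measure (Ed d))) {Λ : Set (E2 d)} {c : Λ → ℂ}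
    (hc : InSynthKernel g Λ c) : HasSum (fun l : Λ => c l • tfLp hg (l : E2 d)) 0 := by
  rw [InSynthKernel] at hc
  simp only [integral_norm_sum_tfShift_sq hg] at hc
  have := (Real.continuous_sqrt.tendsto 0).comp hc
  rw [Real.sqrt_zero] at this
  refine tendsto_zero_iff_norm_tendsto_zero.2 (this.congr fun s => ?_)
  simp [Real.sqrt_sq]

theorem GaborFrame.hilbert {d : ℕ} {g : Ed d → ℂ} (hg : MemLp g 2 (volume : Measure (Ed d)))
    {Λ : Set (E2 d)} {A B : ℝ} (h : GaborFrame g Λ A B)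
    (f : Lp ℂ 2 (volume : Measure (Ed d))) :
    (Summable fun l : Λ => ‖inner ℂ (tfLp hg (l : E2 d)) f‖ ^ 2) ∧
    A * ‖f‖ ^ 2 ≤ ∑' l : Λ, ‖inner ℂ (tfLp hg (l : E2 d)) f‖ ^ 2 ∧
    ∑' l : Λ, ‖inner ℂ (tfLp hg (l : E2 d)) f‖ ^ 2 ≤ B * ‖f‖ ^ 2 := by
  obtain ⟨hA, hB, h⟩ := h
  have hf := Lp.memLp f
  have h1 := h f hf
  have h2 : ∀ l : Λ, L2inner f (tfShift (l : E2 d) g) = inner ℂ (tfLp hg (l : E2 d)) f := by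
    intro l
    rw [L2inner_eq_inner_toLp hf (memLp_tfShift _ hg), Lp.toLp_coeFn, tfLp]
  have h3 : L2normSq f = ‖f‖ ^ 2 := by
    rw [L2normSq, integral_norm_sq_eq_norm_toLp_sq hf, Lp.toLp_coeFn]
  simp only [h2, h3] at h1
  refine ⟨?_, h1⟩
  by_contra hs
  rw [tsum_eq_zero_of_not_summable hs] at h1
  have h4 : ‖f‖ = 0 := by
    by_contra hne
    have : 0 < A * ‖f‖ ^ 2 := by positivity
    linarith [h1.1]
  rw [norm_eq_zero] at h4
  subst h4
  exact hs (by simp)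

theorem exists_tsum_ambig_mul_exp_le {d : ℕ} {a b : ℝ} (ha : 0 < a) (hb0 : 0 < b) (hb1 : b < 1)
    {g : Ed d → ℂ} (hg : MemLp g 2 (volume : Measure (Ed d)))
    (hint : ∫⁻ z : E2 d,
      ENNReal.ofReal (‖L2inner g (tfShift z g)‖ * Real.exp (a * ‖z‖ ^ b)) < ⊤)
    {Λ : Set (E2 d)} (hΛc : Λ.Countable) (hΛs : RelativelySeparated Λ) :
    ∃ K : ℝ≥0, ∀ y : E2 d,
      ∑' l : Λ, ambig g (l - y) * ENNReal.ofReal (Real.exp (a * ‖(l - y : E2 d)‖ ^ b)) ≤ K := by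
  obtain ⟨K, hK, h⟩ := exists_tsum_ambig_mul_le hg
    (v := fun z => ENNReal.ofReal (Real.exp (a * ‖z‖ ^ b))) (by fun_prop)
    (fun z => ENNReal.one_le_ofReal.2 (Real.one_le_exp (by positivity)))
    (fun z w u => by
      rw [← ENNReal.ofReal_mul (by positivity), ← ENNReal.ofReal_mul (by positivity),
        ← Real.exp_add, ← Real.exp_add]
      refine ENNReal.ofReal_le_ofReal (Real.exp_le_exp.2 ?_)
      rw [← mul_add, ← mul_add]
      gcongr
      calc ‖z‖ ^ b ≤ (‖w‖ + (‖u‖ + ‖w + u - z‖)) ^ b := by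
            gcongr
            calc ‖z‖ = ‖w + (u - (w + u - z))‖ := by congr 1; abel
              _ ≤ _ := (norm_add_le _ _).trans (by gcongr; exact norm_sub_le _ _)
        _ ≤ ‖w‖ ^ b + (‖u‖ + ‖w + u - z‖) ^ b :=
            Real.rpow_add_le_add_rpow (by positivity) (by positivity) hb0.le hb1.le
        _ ≤ _ := by
            gcongr
            exact Real.rpow_add_le_add_rpow (by positivity) (by positivity) hb0.le hb1.le)
    (fun n => ⟨ENNReal.ofReal (Real.exp (a * (n : ℝ) ^ b)), ENNReal.ofReal_ne_top, fun z hz =>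
      ENNReal.ofReal_le_ofReal (by
        have : ‖z‖ ≤ n := by simpa using hz
        gcongr)⟩)
    (by
      refine (lt_of_eq_of_lt (lintegral_congr fun z => ?_) hint).ne
      rw [ENNReal.ofReal_mul (norm_nonneg _), ofReal_norm, ambig]) hΛc hΛs
  lift K to ℝ≥0 using hK
  exact ⟨K, h⟩

/-- The Gram matrix of `G(g, Λ)` is almost unchanged by conjugation with a suitable weight which
is comparable to `exp (α * ‖z‖ ^ b)`. -/
theorem exists_gram_perturbation_le {d : ℕ} {a b α B : ℝ} (hb0 : 0 < b)
    (hb1 : b < 1) (hα : 0 < α) (hαa : α < a) (hB : 0 < B)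
    {g : Ed d → ℂ} (hg : MemLp g 2 (volume : Measure (Ed d)))
    (hint : ∫⁻ z : E2 d,
      ENNReal.ofReal (‖L2inner g (tfShift z g)‖ * Real.exp (a * ‖z‖ ^ b)) < ⊤)
    {Λ : Set (E2 d)} (hΛc : Λ.Countable) (hΛs : RelativelySeparated Λ) {δ : ℝ≥0} (hδ : 0 < δ) :
    ∃ R : ℝ, ∀ i : Λ,
      ∑' j : Λ, ‖((B⁻¹ : ℝ) : ℂ) * inner ℂ (tfLp hg (i : E2 d)) (tfLp hg (j : E2 d)) *
        (Real.exp (α * max ‖(i : E2 d)‖ R ^ b - α * max ‖(j : E2 d)‖ R ^ b) - 1 : ℝ)‖ₑ ≤ δ ∧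
      ∑' j : Λ, ‖((B⁻¹ : ℝ) : ℂ) * inner ℂ (tfLp hg (j : E2 d)) (tfLp hg (i : E2 d)) *
        (Real.exp (α * max ‖(j : E2 d)‖ R ^ b - α * max ‖(i : E2 d)‖ R ^ b) - 1 : ℝ)‖ₑ ≤ δ := by
  obtain ⟨K, hK⟩ := exists_tsum_ambig_mul_exp_le (hα.trans hαa) hb0 hb1 hg hint hΛc hΛs
  have hε : 0 < δ * B / (K + 1) := by positivity
  obtain ⟨R, -, hR⟩ := exists_abs_exp_rpow_max_sub_one_le hb0 hb1 hα hαa hε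
  set ε := δ * B / (K + 1) with hεdef
  have hentry : ∀ i j : Λ,
      ‖((B⁻¹ : ℝ) : ℂ) * inner ℂ (tfLp hg (i : E2 d)) (tfLp hg (j : E2 d)) *
        (Real.exp (α * max ‖(i : E2 d)‖ R ^ b - α * max ‖(j : E2 d)‖ R ^ b) - 1 : ℝ)‖ₑ
      ≤ ENNReal.ofReal (B⁻¹ * ε) *
        (ambig g (i - j) * ENNReal.ofReal (Real.exp (a * ‖(i - j : E2 d)‖ ^ b))) := by
    intro i j
    have h1 : ‖((Real.exp (α * max ‖(i : E2 d)‖ R ^ b - α * max ‖(j : E2 d)‖ R ^ b) - 1 : ℝ) :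
        ℂ)‖ₑ ≤ ENNReal.ofReal (ε * Real.exp (a * ‖(i - j : E2 d)‖ ^ b)) := by
      rw [← ofReal_norm, Complex.norm_real]
      exact ENNReal.ofReal_le_ofReal (hR _ _ _ (abs_norm_sub_norm_le _ _))
    have h2 : ‖((B⁻¹ : ℝ) : ℂ)‖ₑ = ENNReal.ofReal B⁻¹ := by
      rw [← ofReal_norm, Complex.norm_real, Real.norm_of_nonneg (by positivity)]
    rw [enorm_mul, enorm_mul, enorm_inner_tfLp, h2]
    refine (mul_le_mul_right h1 _).trans (le_of_eq ?_)
    rw [ENNReal.ofReal_mul hε.le, ENNReal.ofReal_mul (by positivity)]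
    ring
  have hcomm : ∀ i j : Λ, ambig g ((i : E2 d) - j) *
      ENNReal.ofReal (Real.exp (a * ‖(i - j : E2 d)‖ ^ b)) = ambig g ((j : E2 d) - i) *
      ENNReal.ofReal (Real.exp (a * ‖(j - i : E2 d)‖ ^ b)) := by
    intro i j
    rw [norm_sub_rev, ← ambig_neg, neg_sub]
  have hfin : ∀ i : Λ, ∑' j : Λ, ENNReal.ofReal (B⁻¹ * ε) *
      (ambig g (j - i) * ENNReal.ofReal (Real.exp (a * ‖(j - i : E2 d)‖ ^ b))) ≤ δ := by
    intro i
    rw [ENNReal.tsum_mul_left]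
    refine (mul_le_mul_right (hK i) _).trans ?_
    rw [← ENNReal.ofReal_coe_nnreal, ← ENNReal.ofReal_mul (by positivity),
      ← ENNReal.ofReal_coe_nnreal]
    refine ENNReal.ofReal_le_ofReal ?_
    have : B⁻¹ * ε * K = δ * (K / (K + 1)) := by
      rw [hεdef]; field_simp
    rw [this]
    refine mul_le_of_le_one_right δ.2 ((div_le_one (by positivity)).2 (by linarith))
  refine ⟨R, fun i => ⟨?_, ?_⟩⟩
  · refine (ENNReal.tsum_le_tsum fun j => (hentry i j).trans (le_of_eq ?_)).trans (hfin i)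
    rw [hcomm i j]
  · exact (ENNReal.tsum_le_tsum fun j => hentry j i).trans (hfin i)

theorem le_mul_of_finite_section_bounds {r M S N C₁ C₂ P Q e : ℝ} (hP : 0 < P) (hQ : 0 ≤ Q)
    (he : 0 < e) (hM : 0 ≤ M) (hN : 0 ≤ N) (hC₂ : 0 < C₂) (hr : r ≤ M)
    (hdiv : 0 < S → r ≤ N ^ 2 / S)
    (hNe : N ≤ C₁ * e) (hS : 0 ≤ S) (hPQ : P ≤ Q * (√S + C₂ * e)) :
    r ≤ ((2 * C₁ * Q / P) ^ 2 + M * (2 * C₂ * Q / P) ^ 2) * e ^ 2 := by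
  have hQ0 : 0 < Q := by
    rcases hQ.eq_or_lt with h | h
    · rw [← h, zero_mul] at hPQ
      exact absurd hPQ (not_le.2 hP)
    · exact h
  rcases le_total (C₂ * e) (P / (2 * Q)) with h | h
  · have h1 : P / (2 * Q) ≤ √S := by
      have : P / Q ≤ √S + C₂ * e := by rwa [div_le_iff₀' hQ0]
      have h2 : P / Q = P / (2 * Q) + P / (2 * Q) := by field_simp; ring
      linarith
    have h3 : (P / (2 * Q)) ^ 2 ≤ S := by
      calc _ ≤ √S ^ 2 := by gcongr
        _ = S := Real.sq_sqrt hS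
    have hS0 : 0 < S := lt_of_lt_of_le (by positivity) h3
    calc r ≤ N ^ 2 / S := hdiv hS0
      _ ≤ (C₁ * e) ^ 2 / (P / (2 * Q)) ^ 2 := by gcongr
      _ = (2 * C₁ * Q / P) ^ 2 * e ^ 2 := by field_simp
      _ ≤ _ := by
        gcongr
        exact le_add_of_nonneg_right (by positivity)
  · have h1 : 1 ≤ 2 * C₂ * Q / P * e := by
      rw [div_le_iff₀ (by positivity)] at h
      rw [div_mul_eq_mul_div, le_div_iff₀ hP]
      linarith
    calc r ≤ M * 1 := by rwa [mul_one]
      _ ≤ M * (2 * C₂ * Q / P * e) ^ 2 := by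
        gcongr
        exact one_le_pow₀ h1
      _ = M * (2 * C₂ * Q / P) ^ 2 * e ^ 2 := by ring
      _ ≤ _ := by
        gcongr
        exact le_add_of_nonneg_left (by positivity)

end Auxiliary

/-- **Sub-exponential decay of the lower Riesz bound.** For the weight `v(z) = e^{a|z|^b}`
with `a > 0`, `0 < b < 1`, the lower Riesz bounds of the finite sections satisfy
`A_n = O(e^{-a n^b})`. -/
theorem lower_riesz_subexponential_decay {d : ℕ} (a b : ℝ) (ha : 0 < a)
    (hb0 : 0 < b) (hb1 : b < 1)
    (g : Ed d → ℂ) (hg : MemLp g 2 (volume : Measure (Ed d)))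
    (hint : ∫⁻ z : E2 d,
      ENNReal.ofReal (‖L2inner g (tfShift z g)‖ * Real.exp (a * ‖z‖ ^ b)) < ⊤)
    (Λ : Set (E2 d)) (hΛc : Λ.Countable) (hΛs : RelativelySeparated Λ)
    (hframe : ∃ A B : ℝ, GaborFrame g Λ A B)
    (hnotRiesz : ¬ GaborRieszBasis g Λ) :
    ∃ C : ℝ, 0 < C ∧ ∀ n : ℕ, 1 ≤ n →
      lowerRiesz g Λ n ≤ C * Real.exp (-(a * (n : ℝ) ^ b)) := by
  have hker : ∃ c : Λ → ℂ, Summable (fun l : Λ => ‖c l‖ ^ 2) ∧ InSynthKernel g Λ c ∧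
      ∃ k, c k ≠ 0 := by
    by_contra! h
    exact hnotRiesz ⟨hframe, fun c hc hk => h c hc hk⟩
  obtain ⟨c, hc, hck, k, hk⟩ := hker
  obtain ⟨A, B₀, hAB⟩ := hframe
  have hA := hAB.1
  have hB₀ := hAB.2.1
  have hH := hAB.hilbert hg
  set B := A + B₀ with hBdef
  have hB : 0 < B := by positivity
  set ψ : Λ → Lp ℂ 2 (volume : Measure (Ed d)) := fun l => tfLp hg (l : E2 d) with hψ
  set p : lp (fun _ : Λ => ℂ) 2 := ⟨c, memℓp_gen (by simpa using hc)⟩ with hpdef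
  have hp : HasSum (fun l => p l • ψ l) 0 := hasSum_tfLp_of_inSynthKernel hg hck
  set q := √(1 - B⁻¹ * A) with hqdef
  have hq2 : 1 - B⁻¹ * A = B⁻¹ * B₀ := by
    rw [hBdef]; field_simp; ring
  have hq0 : 0 < q := Real.sqrt_pos.2 (by rw [hq2]; positivity)
  have hq1 : q < 1 := by
    rw [hqdef, Real.sqrt_lt' one_pos]
    have : 0 < B⁻¹ * A := by positivity
    linarith
  have hqsq : 1 - B⁻¹ * A ≤ q ^ 2 := (Real.sq_sqrt (by rw [hq2]; positivity)).ge
  set L := -Real.log q with hL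
  have hL0 : 0 < L := neg_pos.2 (Real.log_neg hq0 hq1)
  set δ : NNReal := (L / 2).toNNReal with hδ
  have hδ0 : 0 < δ := Real.toNNReal_pos.2 (by positivity)
  have hδL : (δ : ℝ) = L / 2 := Real.coe_toNNReal _ (by positivity)
  set α := 3 * a / 4 with hα
  obtain ⟨R, hR⟩ := exists_gram_perturbation_le (α := α) (B := B) hb0 hb1 (by positivity)
    (by linarith) hB hg hint hΛc hΛs hδ0
  set φ : Λ → ℝ := fun i => α * max ‖(i : E2 d)‖ R ^ b with hφ
  set C₁ := ‖ψ k‖ + √B * Real.exp (φ k + δ) with hC₁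
  set C₂ := Real.exp (φ k + δ) with hC₂
  have hM : 0 ≤ L2normSq g := integral_nonneg fun t => by positivity
  refine ⟨(2 * C₁ * ‖p‖ / ‖p k‖) ^ 2 + L2normSq g * (2 * C₂ * ‖p‖ / ‖p k‖) ^ 2 + 1,
    by positivity, fun n _ => ?_⟩
  set s : Finset Λ := (finite_norm_le_of_relativelySeparated hΛs n).toFinset with hs
  set N := (n : ℝ) ^ b with hN
  have hN0 : 0 ≤ N := by positivity
  set m := ⌈a / (2 * L) * N⌉₊ with hm
  have hm1 : a / (2 * L) * N ≤ m := Nat.le_ceil _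
  have hm2 : (m : ℝ) ≤ a / (2 * L) * N + 1 := (Nat.ceil_lt_add_one (by positivity)).le
  obtain ⟨x, hx1, hx2⟩ := exists_finset_sum_norm_le ψ hB (fun f => (hH f).1)
    (fun f => (hH f).2.1) (fun f => (hH f).2.2.trans (by gcongr; linarith)) hq0.le hqsq φ δ
    (fun i => (hR i).1) (fun i => (hR i).2) p hp k m s (α * N) (by
      intro i hi
      have hi' : (n : ℝ) < ‖(i : E2 d)‖ := by simpa [hs] using hi
      rw [hφ, hN]
      have := hi'.le.trans (le_max_left _ R)
      simp only
      gcongr)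
  set e := Real.exp (-(a * N / 2)) with he
  have hqm : q ^ m ≤ e := by
    have h1 : q = Real.exp (-L) := by rw [hL, neg_neg, Real.exp_log hq0]
    rw [h1, ← Real.exp_nat_mul, he]
    refine Real.exp_le_exp.2 ?_
    have : a / (2 * L) * N * L ≤ m * L := by gcongr
    have h2 : a / (2 * L) * N * L = a * N / 2 := by field_simp
    linarith
  have hτ : Real.exp (φ k - α * N) * (1 + δ) ^ m ≤ C₂ * e := by
    have h1 : (1 + (δ : ℝ)) ^ m ≤ Real.exp (m * δ) := by
      rw [Real.exp_nat_mul]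
      gcongr
      linarith [Real.add_one_le_exp (δ : ℝ)]
    refine (mul_le_mul_of_nonneg_left h1 (by positivity)).trans ?_
    rw [hC₂, he, ← Real.exp_add, ← Real.exp_add]
    refine Real.exp_le_exp.2 ?_
    have h2 : (m : ℝ) * δ ≤ (a / (2 * L) * N + 1) * δ := by gcongr
    have h3 : a / (2 * L) * N * δ = a * N / 4 := by rw [hδL]; field_simp; ring
    have h4 : α * N = 3 * (a * N) / 4 := by rw [hα]; ring
    linarith
  have hfin := le_mul_of_finite_section_bounds (r := lowerRiesz g Λ n) (S := ∑ i ∈ s, ‖x i‖ ^ 2)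
    (N := ‖∑ i ∈ s, x i • ψ i‖) (C₁ := C₁) (C₂ := C₂) (P := ‖p k‖) (Q := ‖p‖) (e := e)
    (M := L2normSq g) (norm_pos_iff.2 hk) (norm_nonneg _) (by positivity) hM (norm_nonneg _)
    (by positivity) (lowerRiesz_le_L2normSq hg Λ n)
    (lowerRiesz_le_div hg s x (fun l hl => by simpa [hs] using hl))
    (hx1.trans (by
      calc _ ≤ e * ‖ψ k‖ + √B * (C₂ * e) := by gcongr
        _ = C₁ * e := by rw [hC₁]; ring))
    (by positivity) (hx2.trans (by gcongr))
  have he2 : e ^ 2 = Real.exp (-(a * N)) := by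
    rw [he, ← Real.exp_nat_mul]; congr 1; push_cast; ring
  rw [he2] at hfin
  exact hfin.trans (mul_le_mul_of_nonneg_right (le_add_of_nonneg_right zero_le_one)
    (Real.exp_pos _).le)
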